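/- arXiv:math/0505129 — 2 statements merged into one kernel-verified Lean document; each statement's English description precedes it below -/
import Mathlib

section
/- Let M be an s×n integer matrix (n ≥ s ≥ 1) whose columns span ℝˢ and whose convex hull does not contain the origin, let Ω be a fundamental M-cone, and let b ∈ ℤˢ ∩ closure(Ω). Let P := {x ∈ ℝⁿ : x ≥ 0, Mx = b}. Then there exist polynomials q_θ : ℝ → ℂ, one for each θ ∈ A(M), with deg q_θ ≤ n − s − κ_θ where κ_θ := n − #M_θ, such that for every positive integer g, the number of lattice points #(gP ∩ ℤⁿ) equals ∑_{θ∈A(M)} (θ^b)^g · q_θ(g). -/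
open scoped Pointwise
/-- The `j`-th column of `M`, as a vector of `ℝˢ`. -/
def col (s n : ℕ) (M : Matrix (Fin s) (Fin n) ℤ) (j : Fin n) : Fin s → ℝ :=
  fun i => (M i j : ℝ)

/-- The cone spanned by the columns of `M` with indices in `J`. -/
def coneOf (s n : ℕ) (M : Matrix (Fin s) (Fin n) ℤ) (J : Finset (Fin n)) :
    Set (Fin s → ℝ) :=
  {x | ∃ a : Fin n → ℝ, (∀ j, 0 ≤ a j) ∧ (∀ j ∉ J, a j = 0) ∧ x = ∑ j, a j • col s n M j}

/-- `c(M)`: the union of `cone(M∖Y)` over column subsets `Y` with `M∖Y` not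
spanning `ℝˢ`. -/
def badSet (s n : ℕ) (M : Matrix (Fin s) (Fin n) ℤ) : Set (Fin s → ℝ) :=
  ⋃ J ∈ {J : Finset (Fin n) | Submodule.span ℝ (col s n M '' ↑J) ≠ ⊤}, coneOf s n M J

/-- `Ω` is a fundamental `M`-cone: a connected component of `cone°(M) ∖ c(M)`. -/
def IsFundCone (s n : ℕ) (M : Matrix (Fin s) (Fin n) ℤ) (Ω : Set (Fin s → ℝ)) : Prop :=
  ∃ x ∈ interior (coneOf s n M Finset.univ) \ badSet s n M,
    Ω = connectedComponentIn (interior (coneOf s n M Finset.univ) \ badSet s n M) x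

/-- `θ^y := θ₁^{y₁} ⋯ θ_s^{y_s}` for `θ ∈ ℂˢ` and `y ∈ ℤˢ`. -/
noncomputable def charP (s : ℕ) (θ : Fin s → ℂ) (y : Fin s → ℤ) : ℂ := ∏ i, θ i ^ y i

/-- `A(M)`: the set of `θ ∈ (ℂ∖{0})ˢ` such that the columns `m` of `M` with `θ^m = 1`
span `ℝˢ`. -/
def Aset (s n : ℕ) (M : Matrix (Fin s) (Fin n) ℤ) : Set (Fin s → ℂ) :=
  {θ | (∀ i, θ i ≠ 0) ∧
    Submodule.span ℝ (col s n M '' {j | charP s θ (fun i => M i j) = 1}) = ⊤}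

/-- The index set of the columns constituting `M_θ`. -/
noncomputable def idxSet (s n : ℕ) (M : Matrix (Fin s) (Fin n) ℤ) (θ : Fin s → ℂ) :
    Finset (Fin n) :=
  (Set.toFinite {j : Fin n | charP s θ (fun i => M i j) = 1}).toFinset

section WeightedCount

variable {s n : ℕ} {K ι : Type*} [Field K]

/-- Integer points of the fibre of `M` over `y` that satisfy `x i ≥ k i` for `i ∈ S` and
`x i = k i` for `i ∉ S`. -/
def fiberPts (M : Matrix (Fin s) (Fin n) ℤ) (S : Finset (Fin n)) (k : Fin n → ℤ)
    (y : Fin s → ℤ) : Set (Fin n → ℤ) :=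
  {x | M.mulVec x = y ∧ (∀ i ∈ S, k i ≤ x i) ∧ ∀ i ∉ S, x i = k i}

/-- The columns with indices in `F` form a basis of `ℝˢ`. -/
def IsColBasis (M : Matrix (Fin s) (Fin n) ℤ) (F : Finset (Fin n)) : Prop :=
  Submodule.span ℝ (col s n M '' ↑F) = ⊤ ∧ F.card = s

/-- `p` lies in the relative interior of the cone spanned by the columns in `F`. -/
def PosOn (M : Matrix (Fin s) (Fin n) ℤ) (p : Fin s → ℝ) (F : Finset (Fin n)) : Prop :=
  ∃ ξ : Fin n → ℝ, (∀ i ∈ F, 0 < ξ i) ∧ (∀ i ∉ F, ξ i = 0) ∧ ∑ j, ξ j • col s n M j = p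

/-- The weighted number of points of `fiberPts`. -/
noncomputable def weightedCount (M : Matrix (Fin s) (Fin n) ℤ) (w : Fin n → K)
    (S : Finset (Fin n)) (k : Fin n → ℤ) (y : Fin s → ℤ) : K :=
  ∑ᶠ x ∈ fiberPts M S k y, ∏ i, w i ^ x i

/-- The contribution of a vertex (indexed by the column basis `F`) to the weighted count. -/
noncomputable def vertexTerm (M : Matrix (Fin s) (Fin n) ℤ) (w : Fin n → K) (H : Finset ι)
    (χ : ι → AddChar (Fin s → ℤ) K) (S F : Finset (Fin n)) (k : Fin n → ℤ)
    (y : Fin s → ℤ) : K :=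
  (H.card : K)⁻¹ * ∑ h ∈ H, χ h y * (∏ i, (w i / χ h (M.col i)) ^ k i) *
    ∏ i ∈ S \ F, (1 - w i / χ h (M.col i))⁻¹

open Classical in
/-- The sum of the contributions of all vertices. -/
noncomputable def vertexSum (M : Matrix (Fin s) (Fin n) ℤ) (w : Fin n → K)
    (H : Finset (Fin n) → Finset ι) (χ : Finset (Fin n) → ι → AddChar (Fin s → ℤ) K)
    (p : Fin s → ℝ) (S : Finset (Fin n)) (k : Fin n → ℤ) (y : Fin s → ℤ) : K :=
  ∑ F, if F ⊆ S ∧ IsColBasis M F ∧ PosOn M p F then vertexTerm M w (H F) (χ F) S F k y else 0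

theorem sum_intCast_smul_col (M : Matrix (Fin s) (Fin n) ℤ) (x : Fin n → ℤ) :
    ∑ j, (x j : ℝ) • col s n M j = fun i => ((M.mulVec x i : ℤ) : ℝ) := by
  ext i
  simp [col, Matrix.mulVec, dotProduct, mul_comm]

theorem addChar_mulVec (M : Matrix (Fin s) (Fin n) ℤ) (ψ : AddChar (Fin s → ℤ) K)
    (x : Fin n → ℤ) : ψ (M.mulVec x) = ∏ i, ψ (M.col i) ^ x i := by
  have h : M.mulVec x = ∑ i, x i • M.col i := by
    ext l
    simp [Matrix.mulVec, dotProduct, Matrix.col, mul_comm]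
  have h2 : ∀ t : Finset (Fin n), ψ (∑ i ∈ t, x i • M.col i) = ∏ i ∈ t, ψ (M.col i) ^ x i := by
    intro t
    induction t using Finset.induction_on with
    | empty => simp
    | insert a t ha ih =>
      rw [Finset.sum_insert ha, Finset.prod_insert ha, AddChar.map_add_eq_mul, ih,
        AddChar.map_zsmul_eq_zpow]
  rw [h, h2]

theorem addChar_ne_zero (ψ : AddChar (Fin s → ℤ) K) (y : Fin s → ℤ) : ψ y ≠ 0 := by
  intro h
  have := AddChar.map_add_eq_mul ψ y (-y)
  rw [h] at this
  simp at this

/-- More than `s` integer columns satisfy a nontrivial integer relation. -/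
theorem exists_int_relation (M : Matrix (Fin s) (Fin n) ℤ) (S : Finset (Fin n))
    (hS : s < S.card) :
    ∃ a : Fin n → ℤ, M.mulVec a = 0 ∧ a ≠ 0 ∧ ∀ i ∉ S, a i = 0 := by
  classical
  have hdep : ¬ LinearIndependent ℤ (fun i : S => M.col i) := by
    intro h
    have := h.fintype_card_le_finrank
    simp at this
    omega
  rw [Fintype.not_linearIndependent_iff] at hdep
  obtain ⟨g, hg, i0, hi0⟩ := hdep
  refine ⟨fun i => if h : i ∈ S then g ⟨i, h⟩ else 0, ?_, ?_, ?_⟩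
  · ext l
    have := congrFun hg l
    simp only [Finset.sum_apply, Pi.smul_apply, Matrix.col, Matrix.transpose_apply,
      smul_eq_mul, Pi.zero_apply] at this
    refine Eq.trans ?_ this
    simp only [Matrix.mulVec, dotProduct]
    rw [← Finset.sum_subset (Finset.subset_univ S)]
    · rw [← Finset.sum_coe_sort S]
      refine Finset.sum_congr rfl fun i _ => ?_
      simp [mul_comm]
    · intro x _ hx
      simp [hx]
  · intro h
    have := congrFun h i0
    simp at this
    exact hi0 this
  · intro i hi
    simp [hi]

theorem finite_fiberPts (M : Matrix (Fin s) (Fin n) ℤ)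
    (hM : ∃ f : (Fin s → ℝ) →ₗ[ℝ] ℝ, ∀ j, 0 < f (col s n M j))
    (S : Finset (Fin n)) (k : Fin n → ℤ) (y : Fin s → ℤ) : (fiberPts M S k y).Finite := by
  obtain ⟨f, hf⟩ := hM
  set B : ℝ := f (fun i => (y i : ℝ)) - ∑ l, k l * f (col s n M l) with hB
  refine (Set.finite_Icc k (fun i => k i + ⌈B / f (col s n M i)⌉)).subset ?_
  rintro x ⟨hx, h1, h2⟩
  have hk : ∀ i, k i ≤ x i := fun i => by
    by_cases hi : i ∈ S
    · exact h1 i hi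
    · exact (h2 i hi).ge
  refine ⟨hk, fun i => ?_⟩
  have e : B = ∑ l, ((x l : ℝ) - k l) * f (col s n M l) := by
    rw [hB, ← hx, ← sum_intCast_smul_col]
    simp [sub_mul]
  have h3 : ((x i : ℝ) - k i) * f (col s n M i) ≤ B := by
    rw [e]
    refine Finset.single_le_sum (f := fun l => ((x l : ℝ) - k l) * f (col s n M l))
      (fun l _ => mul_nonneg ?_ (hf l).le) (Finset.mem_univ i)
    have := hk l
    rw [sub_nonneg]
    exact_mod_cast this
  have h4 : (x i : ℝ) - k i ≤ ⌈B / f (col s n M i)⌉ :=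
    ((le_div_iff₀ (hf i)).2 h3).trans (Int.le_ceil _)
  have h5 : (x i : ℝ) ≤ ((k i + ⌈B / f (col s n M i)⌉ : ℤ) : ℝ) := by
    push_cast
    linarith
  exact_mod_cast h5

theorem weightedCount_sub (M : Matrix (Fin s) (Fin n) ℤ)
    (hM : ∃ f : (Fin s → ℝ) →ₗ[ℝ] ℝ, ∀ j, 0 < f (col s n M j)) (w : Fin n → K)
    (S : Finset (Fin n)) (k : Fin n → ℤ) (y : Fin s → ℤ) (j : Fin n) (hj : j ∈ S) :
    weightedCount M w S k y - weightedCount M w S (Function.update k j (k j + 1)) y =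
      weightedCount M w (S.erase j) k y := by
  have hu : fiberPts M S k y =
      fiberPts M S (Function.update k j (k j + 1)) y ∪ fiberPts M (S.erase j) k y := by
    ext x
    simp only [fiberPts, Set.mem_ofPred_eq, Set.mem_union]
    constructor
    · rintro ⟨h0, h1, h2⟩
      by_cases hx : x j = k j
      · right
        refine ⟨h0, fun i hi => h1 i (Finset.mem_of_mem_erase hi), fun i hi => ?_⟩
        by_cases hij : i = j
        · rw [hij, hx]
        · exact h2 i fun h => hi (Finset.mem_erase.2 ⟨hij, h⟩)
      · left
        refine ⟨h0, fun i hi => ?_, fun i hi => ?_⟩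
        · by_cases hij : i = j
          · subst hij
            have := h1 i hi
            simp only [Function.update_self]
            omega
          · simpa [Function.update_of_ne hij] using h1 i hi
        · have hij : i ≠ j := fun h => hi (h ▸ hj)
          simpa [Function.update_of_ne hij] using h2 i hi
    · rintro (⟨h0, h1, h2⟩ | ⟨h0, h1, h2⟩)
      · refine ⟨h0, fun i hi => ?_, fun i hi => ?_⟩
        · have := h1 i hi
          by_cases hij : i = j
          · subst hij
            simp only [Function.update_self] at this
            omega
          · simpa [Function.update_of_ne hij] using this
        · have hij : i ≠ j := fun h => hi (h ▸ hj)
          simpa [Function.update_of_ne hij] using h2 i hi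
      · refine ⟨h0, fun i hi => ?_, fun i hi => h2 i fun h => hi (Finset.mem_of_mem_erase h)⟩
        by_cases hij : i = j
        · exact (h2 i (by simp [hij])).ge
        · exact h1 i (Finset.mem_erase.2 ⟨hij, hi⟩)
  have hd : Disjoint (fiberPts M S (Function.update k j (k j + 1)) y)
      (fiberPts M (S.erase j) k y) := by
    rw [Set.disjoint_left]
    rintro x ⟨-, h1, -⟩ ⟨-, -, h2⟩
    have e1 := h1 j hj
    have e2 := h2 j (by simp)
    simp only [Function.update_self] at e1
    omega
  unfold weightedCount
  rw [hu, finsum_mem_union hd (finite_fiberPts M hM _ _ _) (finite_fiberPts M hM _ _ _)]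
  ring

theorem weightedCount_add_relation (M : Matrix (Fin s) (Fin n) ℤ) (w : Fin n → K)
    (hw : ∀ i, w i ≠ 0) (S : Finset (Fin n)) (k a : Fin n → ℤ) (y : Fin s → ℤ)
    (ha : M.mulVec a = 0) :
    weightedCount M w S (k + a) y = (∏ i, w i ^ a i) * weightedCount M w S k y := by
  unfold weightedCount
  rw [mul_finsum_mem]
  symm
  refine finsum_mem_eq_of_bijOn (fun x => x + a) ⟨?_, ?_, ?_⟩ ?_
  · rintro x ⟨h0, h1, h2⟩
    refine ⟨by simp [Matrix.mulVec_add, h0, ha], fun i hi => ?_, fun i hi => ?_⟩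
    · simpa using h1 i hi
    · simpa using h2 i hi
  · intro x _ x' _ h
    simpa using h
  · rintro x ⟨h0, h1, h2⟩
    refine ⟨x - a, ⟨by simp [Matrix.mulVec_sub, h0, ha], fun i hi => ?_, fun i hi => ?_⟩,
      by simp⟩
    · have := h1 i hi
      simp only [Pi.add_apply, Pi.sub_apply] at this ⊢
      omega
    · have := h2 i hi
      simp only [Pi.add_apply, Pi.sub_apply] at this ⊢
      omega
  · intro x _
    rw [← Finset.prod_mul_distrib]
    refine Finset.prod_congr rfl fun i _ => ?_
    rw [Pi.add_apply, zpow_add₀ (hw i), mul_comm]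

theorem vertexSum_add_relation (M : Matrix (Fin s) (Fin n) ℤ) (w : Fin n → K)
    (hw : ∀ i, w i ≠ 0) (H : Finset (Fin n) → Finset ι)
    (χ : Finset (Fin n) → ι → AddChar (Fin s → ℤ) K) (p : Fin s → ℝ)
    (S : Finset (Fin n)) (k a : Fin n → ℤ) (y : Fin s → ℤ) (ha : M.mulVec a = 0) :
    vertexSum M w H χ p S (k + a) y = (∏ i, w i ^ a i) * vertexSum M w H χ p S k y := by
  unfold vertexSum
  rw [Finset.mul_sum]
  refine Finset.sum_congr rfl fun F _ => ?_
  rw [mul_ite, mul_zero]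
  congr 1
  unfold vertexTerm
  rw [mul_left_comm]
  congr 1
  rw [Finset.mul_sum]
  refine Finset.sum_congr rfl fun h _ => ?_
  have e : ∏ i, (w i / χ F h (M.col i)) ^ (k + a) i =
      (∏ i, w i ^ a i) * ∏ i, (w i / χ F h (M.col i)) ^ k i := by
    have e1 : ∏ i, (χ F h (M.col i)) ^ a i = 1 := by
      rw [← addChar_mulVec, ha, AddChar.map_zero_eq_one]
    have e2 : ∀ i, (w i / χ F h (M.col i)) ^ (k + a) i =
        w i ^ a i * (w i / χ F h (M.col i)) ^ k i / χ F h (M.col i) ^ a i := fun i => by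
      rw [Pi.add_apply, zpow_add₀ (div_ne_zero (hw i) (addChar_ne_zero _ _)), div_zpow _ _ (a i)]
      ring
    rw [Finset.prod_congr rfl fun i _ => e2 i, Finset.prod_div_distrib, e1, div_one,
      Finset.prod_mul_distrib]
  rw [e]
  ring

/-- For generic weights, a character matching the weights on a column basis matches them on no
other column. -/
theorem div_addChar_ne_one (M : Matrix (Fin s) (Fin n) ℤ) (w : Fin n → K)
    (hgen : ∀ a : Fin n → ℤ, M.mulVec a = 0 → a ≠ 0 → ∏ i, w i ^ a i ≠ 1)
    (F : Finset (Fin n)) (hF : IsColBasis M F) (ψ : AddChar (Fin s → ℤ) K)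
    (hψ : ∀ i ∈ F, ψ (M.col i) = w i) (j : Fin n) (hj : j ∉ F) : w j / ψ (M.col j) ≠ 1 := by
  intro h
  rw [div_eq_one_iff_eq (addChar_ne_zero _ _)] at h
  obtain ⟨a, ha, ha0, hsupp⟩ := exists_int_relation M (insert j F) (by
    rw [Finset.card_insert_of_notMem hj, hF.2]; omega)
  refine hgen a ha ha0 ?_
  have := addChar_mulVec M ψ a
  rw [ha, AddChar.map_zero_eq_one] at this
  rw [this]
  refine Finset.prod_congr rfl fun i _ => ?_
  by_cases hi : i ∈ insert j F
  · rcases Finset.mem_insert.1 hi with rfl | hi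
    · rw [h]
    · rw [hψ i hi]
  · simp [hsupp i hi]

theorem vertexSum_sub (M : Matrix (Fin s) (Fin n) ℤ) (w : Fin n → K)
    (hw : ∀ i, w i ≠ 0)
    (hgen : ∀ a : Fin n → ℤ, M.mulVec a = 0 → a ≠ 0 → ∏ i, w i ^ a i ≠ 1)
    (H : Finset (Fin n) → Finset ι) (χ : Finset (Fin n) → ι → AddChar (Fin s → ℤ) K)
    (hχ : ∀ F, IsColBasis M F → ∀ h ∈ H F, ∀ i ∈ F, χ F h (M.col i) = w i)
    (p : Fin s → ℝ) (S : Finset (Fin n)) (k : Fin n → ℤ) (y : Fin s → ℤ) (j : Fin n)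
    (hj : j ∈ S) :
    vertexSum M w H χ p S k y - vertexSum M w H χ p S (Function.update k j (k j + 1)) y =
      vertexSum M w H χ p (S.erase j) k y := by
  unfold vertexSum
  rw [← Finset.sum_sub_distrib]
  refine Finset.sum_congr rfl fun F _ => ?_
  by_cases hB : IsColBasis M F ∧ PosOn M p F
  swap
  · simp [hB]
  simp only [hB, and_true]
  have hupd : ∀ h, ∏ i, (w i / χ F h (M.col i)) ^ (Function.update k j (k j + 1)) i =
      (w j / χ F h (M.col j)) * ∏ i, (w i / χ F h (M.col i)) ^ k i := fun h => by
    rw [← Finset.mul_prod_erase _ _ (Finset.mem_univ j),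
      ← Finset.mul_prod_erase (a := j) _ (fun i => (w i / χ F h (M.col i)) ^ k i)
        (Finset.mem_univ j), Function.update_self,
      zpow_add_one₀ (div_ne_zero (hw j) (addChar_ne_zero _ _))]
    have : ∏ i ∈ Finset.univ.erase j,
        (w i / χ F h (M.col i)) ^ (Function.update k j (k j + 1)) i =
        ∏ i ∈ Finset.univ.erase j, (w i / χ F h (M.col i)) ^ k i := by
      refine Finset.prod_congr rfl fun i hi => ?_
      rw [Function.update_of_ne (Finset.ne_of_mem_erase hi)]
    rw [this]
    ring
  by_cases hjF : j ∈ F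
  · have h1 : ¬ F ⊆ S.erase j := fun h => by simpa using h hjF
    rw [if_neg h1, sub_eq_zero]
    congr 1
    unfold vertexTerm
    congr 1
    refine Finset.sum_congr rfl fun h hh => ?_
    rw [hupd, hχ F hB.1 h hh j hjF, div_self (hw j), one_mul]
  · have h1 : F ⊆ S.erase j ↔ F ⊆ S := by
      rw [Finset.subset_erase]
      simp [hjF]
    simp only [h1]
    by_cases hFS : F ⊆ S
    swap
    · simp [hFS]
    simp only [hFS, if_true]
    unfold vertexTerm
    rw [← mul_sub, ← Finset.sum_sub_distrib]
    congr 1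
    refine Finset.sum_congr rfl fun h hh => ?_
    have hS : S \ F = insert j (S.erase j \ F) := by
      ext i
      by_cases hij : i = j
      · simp [hij, hj, hjF]
      · simp [hij]
    have hne : 1 - w j / χ F h (M.col j) ≠ 0 :=
      sub_ne_zero.2 (div_addChar_ne_one M w hgen F hB.1 _ (hχ F hB.1 h hh) j hjF).symm
    rw [hupd, hS, Finset.prod_insert (by simp)]
    set r := w j / χ F h (M.col j)
    calc _ = χ F h y * (∏ i, (w i / χ F h (M.col i)) ^ k i) *
        (∏ i ∈ S.erase j \ F, (1 - w i / χ F h (M.col i))⁻¹) * ((1 - r) * (1 - r)⁻¹) := by ring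
      _ = _ := by rw [mul_inv_cancel₀ hne, mul_one]

theorem sum_smul_col_mem_span (M : Matrix (Fin s) (Fin n) ℤ) (S : Finset (Fin n))
    (ξ : Fin n → ℝ) (hξ : ∀ i ∉ S, ξ i = 0) :
    ∑ j, ξ j • col s n M j ∈ Submodule.span ℝ (col s n M '' ↑S) := by
  refine Submodule.sum_mem _ fun j _ => ?_
  by_cases hj : j ∈ S
  · exact Submodule.smul_mem _ _ (Submodule.subset_span ⟨j, hj, rfl⟩)
  · simp [hξ j hj]

/-- Coordinates with respect to a column basis are unique. -/
theorem IsColBasis.eq_of_sum_eq {M : Matrix (Fin s) (Fin n) ℤ} {F : Finset (Fin n)}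
    (hF : IsColBasis M F) {ξ ξ' : Fin n → ℝ} (h : ∀ i ∉ F, ξ i = 0) (h' : ∀ i ∉ F, ξ' i = 0)
    (e : ∑ j, ξ j • col s n M j = ∑ j, ξ' j • col s n M j) : ξ = ξ' := by
  have hli : LinearIndependent ℝ (fun i : F => col s n M i) := by
    refine linearIndependent_of_top_le_span_of_card_eq_finrank ?_ ?_
    · rw [← hF.1]
      refine le_of_eq ?_
      congr 1
      ext v
      simp
    · simp [hF.2]
  rw [Fintype.linearIndependent_iff] at hli
  have h0 : ∑ i : F, (ξ i - ξ' i) • col s n M i = 0 := by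
    rw [Finset.sum_coe_sort F (fun i => (ξ i - ξ' i) • col s n M i),
      Finset.sum_subset (Finset.subset_univ F)]
    · simp only [sub_smul, Finset.sum_sub_distrib, e, sub_self]
    · intro i _ hi
      simp [h i hi, h' i hi]
  ext i
  by_cases hi : i ∈ F
  · exact sub_eq_zero.1 (hli _ h0 ⟨i, hi⟩)
  · rw [h i hi, h' i hi]

theorem span_ne_top_of_card_lt (M : Matrix (Fin s) (Fin n) ℤ) (S : Finset (Fin n))
    (hS : S.card < s) : Submodule.span ℝ (col s n M '' ↑S) ≠ ⊤ := by
  classical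
  intro h
  have h1 := finrank_span_finset_le_card (R := ℝ) (S.image (col s n M))
  rw [Finset.coe_image, Set.finrank, h, finrank_top] at h1
  have h2 : (S.image (col s n M)).card ≤ S.card := Finset.card_image_le
  simp at h1
  omega

/-- The weighted count over a column basis is given by its single vertex. -/
theorem weightedCount_eq_vertexSum_of_isColBasis (M : Matrix (Fin s) (Fin n) ℤ)
    (w : Fin n → K) (hw : ∀ i, w i ≠ 0)
    (H : Finset (Fin n) → Finset ι) (χ : Finset (Fin n) → ι → AddChar (Fin s → ℤ) K)
    (hχ : ∀ F, IsColBasis M F → ∀ h ∈ H F, ∀ i ∈ F, χ F h (M.col i) = w i)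
    (hcard : ∀ F, IsColBasis M F → ((H F).card : K) ≠ 0)
    (hzero : ∀ F, IsColBasis M F → ∀ y : Fin s → ℤ,
      (∀ x : Fin n → ℤ, (∀ i ∉ F, x i = 0) → M.mulVec x ≠ y) → ∑ h ∈ H F, χ F h y = 0)
    (p : Fin s → ℝ)
    (hp : ∀ J : Finset (Fin n), Submodule.span ℝ (col s n M '' ↑J) ≠ ⊤ →
      p ∉ Submodule.span ℝ (col s n M '' ↑J))
    (y : Fin s → ℤ) (S : Finset (Fin n)) (hS : IsColBasis M S) (η : Fin n → ℝ)
    (k : Fin n → ℤ) (hη : (fun i => (y i : ℝ)) + ∑ j, η j • col s n M j = p)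
    (hk : ∀ i ∈ S, 0 ≤ k i + η i ∧ k i + η i ≤ 1) (hk' : ∀ i ∉ S, k i + η i = 0) :
    weightedCount M w S k y = vertexSum M w H χ p S k y := by
  classical
  have hR : vertexSum M w H χ p S k y =
      if PosOn M p S then vertexTerm M w (H S) (χ S) S S k y else 0 := by
    unfold vertexSum
    rw [Finset.sum_eq_single S]
    · simp [hS]
    · intro F _ hF
      rw [if_neg]
      rintro ⟨h1, h2, -⟩
      exact hF (Finset.eq_of_subset_of_card_le h1 (by rw [hS.2, h2.2]))
    · simp
  -- the part of `y` to be covered by the basis columns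
  set k0 : Fin n → ℤ := fun i => if i ∈ S then 0 else k i with hk0
  have hterm : ∀ h ∈ H S, χ S h y * (∏ i, (w i / χ S h (M.col i)) ^ k i) *
      ∏ i ∈ S \ S, (1 - w i / χ S h (M.col i))⁻¹ =
      χ S h (y - M.mulVec k0) * ∏ i, w i ^ k0 i := by
    intro h hh
    rw [sub_eq_add_neg, AddChar.map_add_eq_mul, AddChar.map_neg_eq_inv, addChar_mulVec,
      Finset.sdiff_self, Finset.prod_empty, mul_one, mul_assoc, ← Finset.prod_inv_distrib,
      ← Finset.prod_mul_distrib]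
    congr 1
    refine Finset.prod_congr rfl fun i _ => ?_
    by_cases hi : i ∈ S
    · simp [hk0, hi, hχ S hS h hh i hi, div_self (hw i)]
    · simp only [hk0, hi, if_false, div_zpow]
      ring
  have hsum : vertexTerm M w (H S) (χ S) S S k y =
      ((H S).card : K)⁻¹ * ((∑ h ∈ H S, χ S h (y - M.mulVec k0)) * ∏ i, w i ^ k0 i) := by
    unfold vertexTerm
    rw [Finset.sum_congr rfl hterm, Finset.sum_mul]
  by_cases hex : ∃ x : Fin n → ℤ, (∀ i ∉ S, x i = 0) ∧ M.mulVec x = y - M.mulVec k0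
  swap
  · have hz : ∑ h ∈ H S, χ S h (y - M.mulVec k0) = 0 :=
      hzero S hS _ fun x hx hx' => hex ⟨x, hx, hx'⟩
    have hL : fiberPts M S k y = ∅ := by
      rw [Set.eq_empty_iff_forall_notMem]
      rintro x ⟨h0, -, h2⟩
      refine hex ⟨x - k0, fun i hi => by simp [hk0, hi, h2 i hi], ?_⟩
      rw [Matrix.mulVec_sub, h0]
    rw [hR, hsum, hz]
    simp [weightedCount, hL]
  obtain ⟨x0, hx0, hx0y⟩ := hex
  have hval : vertexTerm M w (H S) (χ S) S S k y = ∏ i, w i ^ (x0 + k0) i := by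
    have h1 : ∑ h ∈ H S, χ S h (y - M.mulVec k0) = (H S).card * ∏ i, w i ^ x0 i := by
      rw [Finset.sum_congr rfl (g := fun _ => ∏ i, w i ^ x0 i)]
      · simp
      · intro h hh
        rw [← hx0y, addChar_mulVec]
        refine Finset.prod_congr rfl fun i _ => ?_
        by_cases hi : i ∈ S
        · rw [hχ S hS h hh i hi]
        · simp [hx0 i hi]
    rw [hsum, h1, ← mul_assoc, ← mul_assoc, inv_mul_cancel₀ (hcard S hS), one_mul,
      ← Finset.prod_mul_distrib]
    refine Finset.prod_congr rfl fun i _ => ?_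
    rw [Pi.add_apply, zpow_add₀ (hw i)]
  have hxy : M.mulVec (x0 + k0) = y := by
    rw [Matrix.mulVec_add, hx0y]
    simp
  have hxk : ∀ i ∉ S, (x0 + k0) i = k i := fun i hi => by simp [hx0 i hi, hk0, hi]
  -- the real solution `x + η` supported on `S`
  have hreal : ∀ x : Fin n → ℤ, M.mulVec x = y →
      ∑ j, ((x j : ℝ) + η j) • col s n M j = p := by
    intro x hx
    simp only [add_smul, Finset.sum_add_distrib, sum_intCast_smul_col, hx]
    exact hη
  have hoff : ∀ x : Fin n → ℤ, (∀ i ∉ S, x i = k i) → ∀ i ∉ S, (x i : ℝ) + η i = 0 := by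
    intro x hx i hi
    rw [hx i hi, hk' i hi]
  have hsol := hreal _ hxy
  have hne : ∀ i ∈ S, (((x0 + k0) i : ℤ) : ℝ) + η i ≠ 0 := by
    intro i hi h0
    have hlt : (S.erase i).card < s := by
      rw [Finset.card_erase_of_mem hi, hS.2]
      have := Finset.card_pos.2 ⟨i, hi⟩
      rw [hS.2] at this
      omega
    refine hp (S.erase i) (span_ne_top_of_card_lt M _ hlt) ?_
    rw [← hsol]
    refine sum_smul_col_mem_span M _ _ fun l hl => ?_
    by_cases hli : l = i
    · rw [hli, h0]
    · exact hoff _ hxk l fun h => hl (Finset.mem_erase.2 ⟨hli, h⟩)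
  have hiff : PosOn M p S ↔ ∀ i ∈ S, k i ≤ (x0 + k0) i := by
    constructor
    · rintro ⟨ξ, h1, h2, h3⟩ i hi
      have e := hS.eq_of_sum_eq h2 (hoff _ hxk) (h3.trans hsol.symm)
      have h4 := h1 i hi
      rw [e] at h4
      have h5 := (hk i hi).2
      by_contra hlt
      push Not at hlt
      have h6 : (((x0 + k0) i : ℤ) : ℝ) + 1 ≤ k i := by exact_mod_cast hlt
      linarith
    · intro h
      refine ⟨fun i => (((x0 + k0) i : ℤ) : ℝ) + η i, fun i hi => ?_, hoff _ hxk, hsol⟩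
      refine lt_of_le_of_ne ?_ (hne i hi).symm
      have h1 := (hk i hi).1
      have h2 : (k i : ℝ) ≤ (((x0 + k0) i : ℤ) : ℝ) := by exact_mod_cast h i hi
      linarith
  have huniq : ∀ x ∈ fiberPts M S k y, x = x0 + k0 := by
    rintro x ⟨h0, -, h2⟩
    have e := hS.eq_of_sum_eq (hoff _ h2) (hoff _ hxk) ((hreal _ h0).trans hsol.symm)
    ext i
    have := congrFun e i
    simp only [add_left_inj] at this
    exact_mod_cast this
  rw [hR, hval]
  by_cases hpos : PosOn M p S
  · rw [if_pos hpos]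
    have : fiberPts M S k y = {x0 + k0} :=
      Set.eq_singleton_iff_unique_mem.2 ⟨⟨hxy, hiff.1 hpos, hxk⟩, huniq⟩
    simp [weightedCount, this]
  · rw [if_neg hpos]
    have : fiberPts M S k y = ∅ := by
      rw [Set.eq_empty_iff_forall_notMem]
      intro x hx
      have e := huniq x hx
      subst e
      exact hpos (hiff.2 hx.2.1)
    simp [weightedCount, this]

theorem eventually_ceil_mem {u₀ : ℝ} :
    ∀ᶠ u in nhds u₀, u₀ ≤ (⌈u⌉ : ℝ) ∧ (⌈u⌉ : ℝ) ≤ u₀ + 1 := by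
  have h1 : (⌈u₀⌉ : ℝ) - 1 < u₀ := by
    have := Int.ceil_lt_add_one u₀
    linarith
  have h2 : u₀ < (⌊u₀⌋ : ℝ) + 1 := Int.lt_floor_add_one u₀
  filter_upwards [Ioo_mem_nhds h1 h2] with u hu
  constructor
  · have : ⌈u₀⌉ ≤ ⌈u⌉ := by
      have : ⌈u₀⌉ - 1 < ⌈u⌉ := Int.lt_ceil.2 (by push_cast; exact hu.1)
      omega
    exact (Int.le_ceil u₀).trans (by exact_mod_cast this)
  · have : ⌈u⌉ ≤ ⌊u₀⌋ + 1 := Int.ceil_le.2 (by push_cast; exact hu.2.le)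
    have h : (⌈u⌉ : ℝ) ≤ ⌊u₀⌋ + 1 := by exact_mod_cast this
    linarith [Int.floor_le u₀]

/-- **Brion's formula for generic weights.**  The parameter `η` moves the point `y` to a generic
point `p`, which selects the vertices; the bounds `k` are those allowed by `η`. -/
theorem weightedCount_eq_vertexSum (M : Matrix (Fin s) (Fin n) ℤ)
    (hM : ∃ f : (Fin s → ℝ) →ₗ[ℝ] ℝ, ∀ j, 0 < f (col s n M j))
    (w : Fin n → K) (hw : ∀ i, w i ≠ 0)
    (hgen : ∀ a : Fin n → ℤ, M.mulVec a = 0 → a ≠ 0 → ∏ i, w i ^ a i ≠ 1)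
    (H : Finset (Fin n) → Finset ι) (χ : Finset (Fin n) → ι → AddChar (Fin s → ℤ) K)
    (hχ : ∀ F, IsColBasis M F → ∀ h ∈ H F, ∀ i ∈ F, χ F h (M.col i) = w i)
    (hcard : ∀ F, IsColBasis M F → ((H F).card : K) ≠ 0)
    (hzero : ∀ F, IsColBasis M F → ∀ y : Fin s → ℤ,
      (∀ x : Fin n → ℤ, (∀ i ∉ F, x i = 0) → M.mulVec x ≠ y) → ∑ h ∈ H F, χ F h y = 0)
    (p : Fin s → ℝ)
    (hp : ∀ J : Finset (Fin n), Submodule.span ℝ (col s n M '' ↑J) ≠ ⊤ →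
      p ∉ Submodule.span ℝ (col s n M '' ↑J))
    (y : Fin s → ℤ) (S : Finset (Fin n)) (η : Fin n → ℝ)
    (k : Fin n → ℤ) (hη : (fun i => (y i : ℝ)) + ∑ j, η j • col s n M j = p)
    (hk : ∀ i ∈ S, 0 ≤ k i + η i ∧ k i + η i ≤ 1) (hk' : ∀ i ∉ S, k i + η i = 0) :
    weightedCount M w S k y = vertexSum M w H χ p S k y := by
  classical
  induction S using Finset.strongInduction generalizing η k with
  | H S ih =>
  by_cases hspan : Submodule.span ℝ (col s n M '' ↑S) = ⊤
  swap
  · have hL : fiberPts M S k y = ∅ := by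
      rw [Set.eq_empty_iff_forall_notMem]
      rintro x ⟨h0, -, h2⟩
      refine hp S hspan ?_
      rw [← hη, ← h0, ← sum_intCast_smul_col, ← Finset.sum_add_distrib]
      simp only [← add_smul]
      exact sum_smul_col_mem_span M S _ fun i hi => by rw [h2 i hi, hk' i hi]
    have hR : vertexSum M w H χ p S k y = 0 := by
      refine Finset.sum_eq_zero fun F _ => if_neg ?_
      rintro ⟨h1, h2, -⟩
      refine hspan (top_unique ?_)
      rw [← h2.1]
      exact Submodule.span_mono (Set.image_mono (by exact_mod_cast h1))
    simp [weightedCount, hL, hR]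
  rcases lt_trichotomy S.card s with hlt | heq | hgt
  · exact absurd hspan (span_ne_top_of_card_lt M S hlt)
  · exact weightedCount_eq_vertexSum_of_isColBasis M w hw H χ hχ hcard hzero p hp y S
      ⟨hspan, heq⟩ η k hη hk hk'
  obtain ⟨a, ha, ha0, hsupp⟩ := exists_int_relation M S hgt
  set D : (Fin n → ℤ) → K := fun k => weightedCount M w S k y - vertexSum M w H χ p S k y with hD
  -- `k` is an admissible bound at the offset `η`
  let Adm : (Fin n → ℝ) → (Fin n → ℤ) → Prop := fun η k =>
    (∀ i ∈ S, 0 ≤ k i + η i ∧ k i + η i ≤ 1) ∧ ∀ i ∉ S, k i + η i = 0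
  have hstep : ∀ η : Fin n → ℝ, (fun i => (y i : ℝ)) + ∑ j, η j • col s n M j = p →
      ∀ k j, j ∈ S → Adm η k → Adm η (Function.update k j (k j + 1)) →
      D k = D (Function.update k j (k j + 1)) := by
    intro η hη k j hj h1 h2
    have e1 := (h1.1 j hj).1
    have e2 := (h2.1 j hj).2
    simp only [Function.update_self] at e2
    push_cast at e2
    have e3 := ih (S.erase j) (Finset.erase_ssubset hj) η k hη
      (fun i hi => h1.1 i (Finset.mem_of_mem_erase hi)) (fun i hi => by
        by_cases hij : i = j
        · rw [hij]
          linarith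
        · exact h1.2 i fun h => hi (Finset.mem_erase.2 ⟨hij, h⟩))
    rw [← weightedCount_sub M hM w S k y j hj,
      ← vertexSum_sub M w hw hgen H χ hχ p S k y j hj] at e3
    simp only [hD]
    linear_combination e3
  have hupd : ∀ η : Fin n → ℝ, (fun i => (y i : ℝ)) + ∑ j, η j • col s n M j = p →
      ∀ k j v, Adm η k → Adm η (Function.update k j v) → D k = D (Function.update k j v) := by
    intro η hη k j v h1 h2
    by_cases hj : j ∈ S
    · have a1 := h1.1 j hj
      have a2 := h2.1 j hj
      simp only [Function.update_self] at a2
      have b1 : v ≤ k j + 1 := by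
        have : (v : ℝ) ≤ k j + 1 := by linarith
        exact_mod_cast this
      have b2 : k j ≤ v + 1 := by
        have : (k j : ℝ) ≤ v + 1 := by linarith
        exact_mod_cast this
      rcases (by omega : v = k j + 1 ∨ v = k j ∨ k j = v + 1) with h | h | h
      · subst h
        exact hstep η hη k j hj h1 h2
      · rw [h, Function.update_eq_self]
      · have e : Function.update (Function.update k j v) j
            ((Function.update k j v) j + 1) = k := by
          rw [Function.update_self, Function.update_idem, ← h, Function.update_eq_self]
        have := hstep η hη (Function.update k j v) j hj h2 (by rw [e]; exact h1)
        rw [e] at this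
        exact this.symm
    · have a1 := h1.2 j hj
      have a2 := h2.2 j hj
      simp only [Function.update_self] at a2
      have : (v : ℝ) = k j := by linarith
      have : v = k j := by exact_mod_cast this
      rw [this, Function.update_eq_self]
  have hadm : ∀ η : Fin n → ℝ, (fun i => (y i : ℝ)) + ∑ j, η j • col s n M j = p →
      ∀ k k', Adm η k → Adm η k' → D k = D k' := by
    intro η hη k k' h h'
    have hpw : ∀ t : Finset (Fin n), Adm η (t.piecewise k' k) := fun t => by
      refine ⟨fun i hi => ?_, fun i hi => ?_⟩
      · by_cases hit : i ∈ t
        · simpa [hit] using h'.1 i hi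
        · simpa [hit] using h.1 i hi
      · by_cases hit : i ∈ t
        · simpa [hit] using h'.2 i hi
        · simpa [hit] using h.2 i hi
    have hind : ∀ t : Finset (Fin n), D k = D (t.piecewise k' k) := by
      intro t
      induction t using Finset.induction_on with
      | empty => simp
      | insert j t hj iht =>
        rw [iht, Finset.piecewise_insert]
        refine hupd η hη _ _ _ (hpw t) ?_
        rw [← Finset.piecewise_insert]
        exact hpw _
    simpa using hind Finset.univ
  -- sweep the offset along the relation `a`
  let kt : ℝ → Fin n → ℤ := fun t i => ⌈t * a i - η i⌉
  have hηt : ∀ t : ℝ, (fun i => (y i : ℝ)) + ∑ j, (η j - t * a j) • col s n M j = p := by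
    intro t
    have h1 := sum_intCast_smul_col M a
    rw [ha] at h1
    have h2 : ∑ j, (t * a j) • col s n M j = 0 := by
      simp only [mul_smul, ← Finset.smul_sum, h1]
      ext
      simp
    simp only [sub_smul, Finset.sum_sub_distrib, h2, sub_zero]
    exact hη
  have hoff : ∀ t, ∀ i ∉ S, kt t i = k i := fun t i hi => by
    have h1 := hk' i hi
    have h2 : t * a i - η i = k i := by
      rw [hsupp i hi]
      push_cast
      linarith
    simp only [kt, h2, Int.ceil_intCast]
  have hadm0 : ∀ t t₀ : ℝ, (∀ i, t₀ * a i - η i ≤ kt t i ∧ (kt t i : ℝ) ≤ t₀ * a i - η i + 1) →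
      Adm (fun j => η j - t₀ * a j) (kt t) := by
    intro t t₀ h
    refine ⟨fun i _ => ⟨by linarith [(h i).1], by linarith [(h i).2]⟩, fun i hi => ?_⟩
    show (kt t i : ℝ) + (η i - t₀ * a i) = 0
    rw [hoff t i hi, hsupp i hi]
    push_cast
    linarith [hk' i hi]
  have hself : ∀ t, Adm (fun j => η j - t * a j) (kt t) := fun t =>
    hadm0 t t fun i => ⟨Int.le_ceil _, (Int.ceil_lt_add_one _).le⟩
  have hlc : IsLocallyConstant fun t => D (kt t) := by
    rw [IsLocallyConstant.iff_eventually_eq]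
    intro t₀
    have hev : ∀ᶠ t in nhds t₀, ∀ i, t₀ * a i - η i ≤ (kt t i : ℝ) ∧
        (kt t i : ℝ) ≤ t₀ * a i - η i + 1 := by
      rw [Filter.eventually_all]
      intro i
      have hc : Filter.Tendsto (fun t : ℝ => t * a i - η i) (nhds t₀)
          (nhds (t₀ * a i - η i)) := by
        apply Continuous.tendsto
        fun_prop
      exact hc.eventually eventually_ceil_mem
    filter_upwards [hev] with t ht
    exact hadm _ (hηt t₀) _ _ (hadm0 t t₀ ht) (hself t₀)
  have h01 := hlc.apply_eq_of_preconnectedSpace 0 1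
  have h1 : kt 1 = kt 0 + a := by
    ext i
    simp only [kt, one_mul, zero_mul, Pi.add_apply, zero_sub]
    rw [sub_eq_neg_add, Int.ceil_add_intCast]
  have h2 : D (kt 0 + a) = (∏ i, w i ^ a i) * D (kt 0) := by
    simp only [hD, weightedCount_add_relation M w hw S (kt 0) a y ha,
      vertexSum_add_relation M w hw H χ p S (kt 0) a y ha]
    ring
  have h3 : D (kt 0) = 0 := by
    simp only [h1, h2] at h01
    have h4 : (1 - ∏ i, w i ^ a i) * D (kt 0) = 0 := by linear_combination h01
    exact (mul_eq_zero.1 h4).resolve_left (sub_ne_zero.2 (hgen a ha ha0).symm)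
  have h5 : D k = D (kt 0) := by
    refine hadm η hη _ _ ⟨hk, hk'⟩ ?_
    simpa using hself 0
  rw [h3] at h5
  exact sub_eq_zero.1 h5

end WeightedCount

section Duals

variable {s n : ℕ}

/-- Vectors whose convex hull misses the origin lie in an open half-space. -/
theorem exists_pos_functional (M : Matrix (Fin s) (Fin n) ℤ)
    (h : (0 : Fin s → ℝ) ∉ convexHull ℝ (Set.range (col s n M))) :
    ∃ f : (Fin s → ℝ) →ₗ[ℝ] ℝ, ∀ j, 0 < f (col s n M j) := by
  obtain ⟨f, u, hu, hf⟩ := geometric_hahn_banach_point_closed (convex_convexHull ℝ _)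
    ((Set.finite_range (col s n M)).isCompact_convexHull ℝ).isClosed h
  refine ⟨f, fun j => ?_⟩
  have := hf _ (subset_convexHull ℝ _ (Set.mem_range_self j))
  simp only [map_zero] at hu
  exact hu.trans this

/-- The dual basis of a column basis, scaled to be integral. -/
theorem IsColBasis.exists_dual {M : Matrix (Fin s) (Fin n) ℤ} {F : Finset (Fin n)}
    (hF : IsColBasis M F) :
    ∃ (D : ℕ) (ψ : Matrix (Fin n) (Fin s) ℤ), 0 < D ∧ (∀ k ∉ F, ψ k = 0) ∧
      (∀ k ∈ F, ∀ i ∈ F, (ψ * M) k i = if k = i then (D : ℤ) else 0) ∧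
      M * ψ = (D : ℤ) • (1 : Matrix (Fin s) (Fin s) ℤ) := by
  classical
  obtain ⟨hspan, hcard⟩ := hF
  let e : F ≃ Fin s := F.equivFinOfCardEq hcard
  let A : Matrix (Fin s) (Fin s) ℤ := M.submatrix id (fun j => (e.symm j : Fin n))
  have hli : LinearIndependent ℝ (A.map (Int.castRingHom ℝ)).col := by
    refine linearIndependent_of_top_le_span_of_card_eq_finrank ?_ (by simp)
    rw [← hspan]
    refine Submodule.span_mono ?_
    rintro _ ⟨j, hj, rfl⟩
    refine ⟨e ⟨j, hj⟩, ?_⟩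
    ext l
    simp [A, col, Matrix.col]
  have hdet : A.det ≠ 0 := by
    intro h
    have h1 := (Matrix.isUnit_iff_isUnit_det _).1
      (Matrix.linearIndependent_cols_iff_isUnit.1 hli)
    rw [← RingHom.mapMatrix_apply, ← RingHom.map_det, h] at h1
    simp at h1
  let ψ : Matrix (Fin n) (Fin s) ℤ := fun k =>
    if h : k ∈ F then A.det • A.adjugate (e ⟨k, h⟩) else 0
  have hD : ((A.det ^ 2).natAbs : ℤ) = A.det * A.det := by
    rw [Int.natAbs_of_nonneg (sq_nonneg _), sq]
  refine ⟨(A.det ^ 2).natAbs, ψ, ?_, fun k hk => dif_neg hk, fun k hk i hi => ?_, ?_⟩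
  · exact Int.natAbs_pos.2 (pow_ne_zero _ hdet)
  · have h1 := congrFun (congrFun A.adjugate_mul (e ⟨k, hk⟩)) (e ⟨i, hi⟩)
    simp only [Matrix.mul_apply, Matrix.smul_apply, Matrix.one_apply, smul_eq_mul,
      e.injective.eq_iff, Subtype.mk.injEq] at h1
    have h2 : ∀ l, A l (e ⟨i, hi⟩) = M l i := fun l => by simp [A]
    simp only [h2] at h1
    rw [Matrix.mul_apply, hD]
    simp only [ψ, dif_pos hk, Pi.smul_apply, smul_eq_mul, mul_assoc, ← Finset.mul_sum, h1]
    split_ifs <;> simp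
  · rw [hD]
    ext i l
    have h1 := congrFun (congrFun A.mul_adjugate i) l
    rw [Matrix.mul_apply] at h1
    rw [Matrix.mul_apply, ← Finset.sum_subset (Finset.subset_univ F), ← Finset.sum_coe_sort F]
    · rw [Matrix.smul_apply, mul_smul, ← Matrix.smul_apply, ← h1, smul_eq_mul, Finset.mul_sum]
      refine Fintype.sum_equiv e _ _ fun k => ?_
      simp only [ψ, dif_pos k.2, Pi.smul_apply, smul_eq_mul, A, Matrix.submatrix_apply, id,
        Equiv.symm_apply_apply, Subtype.coe_eta]
      ring
    · intro k _ hk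
      simp [ψ, hk]

theorem sum_smul_col_apply (M : Matrix (Fin s) (Fin n) ℤ) (ξ : Fin n → ℝ) (i : Fin s) :
    (∑ j, ξ j • col s n M j) i = ∑ j, (M i j : ℝ) * ξ j := by
  simp [col, mul_comm]

/-- Positivity on a column basis is detected by the dual basis. -/
theorem posOn_iff_of_dual {M : Matrix (Fin s) (Fin n) ℤ} {F : Finset (Fin n)} {D : ℕ}
    {ψ : Matrix (Fin n) (Fin s) ℤ} (hD : 0 < D) (hψ : ∀ k ∉ F, ψ k = 0)
    (hψM : ∀ k ∈ F, ∀ i ∈ F, (ψ * M) k i = if k = i then (D : ℤ) else 0)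
    (hMψ : M * ψ = (D : ℤ) • (1 : Matrix (Fin s) (Fin s) ℤ)) (p : Fin s → ℝ) :
    PosOn M p F ↔ ∀ k ∈ F, 0 < ∑ l, (ψ k l : ℝ) * p l := by
  have hD' : (0 : ℝ) < D := by exact_mod_cast hD
  constructor
  · rintro ⟨ξ, h1, h2, rfl⟩ k hk
    have : ∑ l, (ψ k l : ℝ) * (∑ j, ξ j • col s n M j) l = ξ k * D := by
      calc _ = ∑ j, ξ j * (((ψ * M) k j : ℤ) : ℝ) := by
            simp only [sum_smul_col_apply, Finset.mul_sum, Matrix.mul_apply, Int.cast_sum,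
              Int.cast_mul]
            rw [Finset.sum_comm]
            refine Finset.sum_congr rfl fun j _ => Finset.sum_congr rfl fun l _ => ?_
            ring
        _ = ξ k * D := by
            rw [Finset.sum_eq_single k]
            · rw [hψM k hk k hk]
              simp
            · intro j _ hj
              by_cases hjF : j ∈ F
              · rw [hψM k hk j hjF, if_neg (Ne.symm hj)]
                simp
              · rw [h2 j hjF, zero_mul]
            · simp
    rw [this]
    exact mul_pos (h1 k hk) hD'
  · intro h
    refine ⟨fun k => (∑ l, (ψ k l : ℝ) * p l) / D, fun k hk => div_pos (h k hk) hD',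
      fun k hk => by simp [hψ k hk], ?_⟩
    ext i
    rw [sum_smul_col_apply]
    have h1 : ∀ l, ∑ j, (M i j : ℝ) * (ψ j l : ℝ) = if i = l then (D : ℝ) else 0 := by
      intro l
      have := congrFun (congrFun hMψ i) l
      rw [Matrix.mul_apply, Matrix.smul_apply, Matrix.one_apply] at this
      have h3 := congrArg (Int.cast : ℤ → ℝ) this
      push_cast at h3
      rw [h3]
      split_ifs <;> simp
    calc _ = (∑ l, (∑ j, (M i j : ℝ) * (ψ j l : ℝ)) * p l) / D := by
          simp only [Finset.mul_sum, Finset.sum_mul, Finset.sum_div]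
          rw [Finset.sum_comm]
          refine Finset.sum_congr rfl fun j _ => Finset.sum_congr rfl fun l _ => ?_
          ring
      _ = p i := by
          simp only [h1, ite_mul, zero_mul, Finset.sum_ite_eq, Finset.mem_univ, if_true]
          field_simp

open Filter Topology in
/-- Small offsets with prescribed genericity. -/
theorem exists_offset (M : Matrix (Fin s) (Fin n) ℤ)
    (hspan : Submodule.span ℝ (Set.range (col s n M)) = ⊤) (b : Fin s → ℝ)
    {ι : Type*} [Finite ι] (φ : ι → (Fin s → ℝ) →ₗ[ℝ] ℝ) (hφ : ∀ i, φ i ≠ 0) :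
    ∃ η : Fin n → ℝ, (∀ j, 0 ≤ η j ∧ η j ≤ 1) ∧ ∀ i,
      φ i (∑ j, η j • col s n M j) ≠ 0 ∧
      (φ i b ≠ 0 → |φ i (∑ j, η j • col s n M j)| < |φ i b|) := by
  let P : ι → Polynomial ℝ := fun i =>
    ∑ j : Fin n, Polynomial.C (φ i (col s n M j)) * Polynomial.X ^ ((j : ℕ) + 1)
  have hP : ∀ i τ, (P i).eval τ = φ i (∑ j : Fin n, τ ^ ((j : ℕ) + 1) • col s n M j) := by
    intro i τ
    simp only [P, Polynomial.eval_finsetSum, map_sum, map_smul, smul_eq_mul,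
      Polynomial.eval_mul, Polynomial.eval_C, Polynomial.eval_pow, Polynomial.eval_X]
    exact Finset.sum_congr rfl fun j _ => mul_comm _ _
  have hP0 : ∀ i, P i ≠ 0 := by
    intro i h
    refine hφ i (LinearMap.ext_on_range hspan fun j => ?_)
    have := congrArg (fun q => Polynomial.coeff q ((j : ℕ) + 1)) h
    simp only [P, Polynomial.finsetSum_coeff, Polynomial.coeff_C_mul, Polynomial.coeff_X_pow,
      Polynomial.coeff_zero] at this
    rw [Finset.sum_eq_single j] at this
    · simpa using this
    · intro k _ hk
      have : (j : ℕ) ≠ k := fun h => hk (Fin.ext h.symm)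
      simp [this]
    · simp
  have e1 : ∀ i, ∀ᶠ τ in 𝓝[>] (0 : ℝ), (P i).eval τ ≠ 0 := by
    intro i
    have hfin : ((↑(P i).roots.toFinset : Set ℝ) \ {0}).Finite :=
      (Finset.finite_toSet _).subset Set.sdiff_subset
    have h1 : ((↑(P i).roots.toFinset : Set ℝ) \ {0})ᶜ ∈ 𝓝 (0 : ℝ) :=
      hfin.isClosed.isOpen_compl.mem_nhds (by simp)
    filter_upwards [mem_nhdsWithin_of_mem_nhds h1, self_mem_nhdsWithin] with τ h2 h3 h4
    refine h2 ⟨?_, ?_⟩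
    · simp [hP0 i, h4]
    · exact (ne_of_gt h3 : τ ≠ 0)
  have e2 : ∀ i, ∀ᶠ τ in 𝓝[>] (0 : ℝ), φ i b ≠ 0 → |(P i).eval τ| < |φ i b| := by
    intro i
    by_cases h : φ i b = 0
    · simp [h]
    have hc : Tendsto (fun τ => |(P i).eval τ|) (𝓝 0) (𝓝 |(P i).eval 0|) :=
      ((P i).continuous.abs).tendsto 0
    have h0 : (P i).eval 0 = 0 := by simp [P, Polynomial.eval_finsetSum]
    rw [h0, abs_zero] at hc
    filter_upwards [nhdsWithin_le_nhds (hc.eventually_lt_const (abs_pos.2 h))] with τ h1 _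
    exact h1
  have e3 : ∀ᶠ τ in 𝓝[>] (0 : ℝ), τ < 1 :=
    nhdsWithin_le_nhds (eventually_lt_nhds one_pos)
  obtain ⟨τ, ⟨⟨h1, h2⟩, h3⟩, h4⟩ := (((eventually_all.2 e1).and (eventually_all.2 e2)).and
    e3 |>.and self_mem_nhdsWithin).exists
  have h4 : 0 < τ := h4
  refine ⟨fun j => τ ^ ((j : ℕ) + 1), fun j => ⟨by positivity, pow_le_one₀ h4.le h3.le⟩,
    fun i => ?_⟩
  rw [← hP]
  exact ⟨h1 i, h2 i⟩

theorem pos_nat_mul_add_iff {x d : ℝ} (hd : d ≠ 0) (hx : x ≠ 0 → |d| < |x|) {g : ℕ}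
    (hg : 0 < g) : g * x + d ≠ 0 ∧ (0 < g * x + d ↔ 0 < x + d) := by
  have hg' : (1 : ℝ) ≤ g := by exact_mod_cast hg
  rcases lt_trichotomy x 0 with h | h | h
  · have h1 := hx h.ne
    rw [abs_of_neg h] at h1
    have h2 := (abs_lt.1 h1).2
    have h3 : g * x ≤ x := by nlinarith
    exact ⟨by linarith, by constructor <;> intro <;> linarith⟩
  · simp [h, hd]
  · have h1 := hx h.ne'
    rw [abs_of_pos h] at h1
    have h2 := (abs_lt.1 h1).1
    have h3 : x ≤ g * x := by nlinarith
    exact ⟨by linarith, by constructor <;> intro <;> linarith⟩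

/-- There is an offset moving all positive multiples of `b` off the walls, uniformly. -/
theorem exists_generic_offset (M : Matrix (Fin s) (Fin n) ℤ)
    (hspan : Submodule.span ℝ (Set.range (col s n M)) = ⊤) (b : Fin s → ℝ) :
    ∃ η : Fin n → ℝ, (∀ j, 0 ≤ η j ∧ η j ≤ 1) ∧ ∀ g : ℕ, 0 < g →
      (∀ J : Finset (Fin n), Submodule.span ℝ (col s n M '' ↑J) ≠ ⊤ →
        (g : ℝ) • b + ∑ j, η j • col s n M j ∉ Submodule.span ℝ (col s n M '' ↑J)) ∧
      ∀ F, IsColBasis M F → (PosOn M ((g : ℝ) • b + ∑ j, η j • col s n M j) F ↔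
        PosOn M (b + ∑ j, η j • col s n M j) F) := by
  have hJ : ∀ J : {J : Finset (Fin n) // Submodule.span ℝ (col s n M '' ↑J) ≠ ⊤},
      ∃ f : (Fin s → ℝ) →ₗ[ℝ] ℝ, f ≠ 0 ∧
        Submodule.span ℝ (col s n M '' (J.1 : Set (Fin n))) ≤ LinearMap.ker f := fun J =>
    Submodule.exists_le_ker_of_lt_top _ (lt_top_iff_ne_top.2 J.2)
  choose f hf0 hf using hJ
  choose D ψ hD hψ hψM hMψ using fun F : {F : Finset (Fin n) // IsColBasis M F} =>
    F.2.exists_dual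
  let T := {t : {F : Finset (Fin n) // IsColBasis M F} × Fin n // t.2 ∈ t.1.1}
  let lin : T → (Fin s → ℝ) →ₗ[ℝ] ℝ := fun t =>
    ∑ l, (ψ t.1.1 t.1.2 l : ℝ) • LinearMap.proj l
  have hlin : ∀ t p, lin t p = ∑ l, (ψ t.1.1 t.1.2 l : ℝ) * p l := by
    intro t p
    simp [lin]
  have hlin0 : ∀ t, lin t ≠ 0 := by
    intro t h
    have h1 := hψM t.1.1 t.1.2 t.2 t.1.2 t.2
    have h2 := hlin t (col s n M t.1.2)
    rw [h, if_pos rfl, Matrix.mul_apply] at *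
    have h3 := congrArg (Int.cast : ℤ → ℝ) h1
    push_cast at h3
    have h4 : (0 : ℝ) = D t.1.1 := by rw [← h3]; simpa [col] using h2
    have := hD t.1.1
    rify at this
    linarith
  obtain ⟨η, hη, h⟩ := exists_offset M hspan b (Sum.elim f lin) (by
    rintro (J | t)
    · exact hf0 J
    · exact hlin0 t)
  refine ⟨η, hη, fun g hg => ⟨fun J hJ hmem => ?_, fun F hF => ?_⟩⟩
  · obtain ⟨h1, h2⟩ := h (Sum.inl ⟨J, hJ⟩)
    refine (pos_nat_mul_add_iff h1 h2 hg).1 ?_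
    have := hf ⟨J, hJ⟩ hmem
    simpa using this
  · have key := posOn_iff_of_dual (hD ⟨F, hF⟩) (hψ ⟨F, hF⟩) (hψM ⟨F, hF⟩) (hMψ ⟨F, hF⟩)
    rw [key, key]
    refine forall₂_congr fun k hk => ?_
    have h3 := hlin ⟨(⟨F, hF⟩, k), hk⟩
    obtain ⟨h1, h2⟩ := h (Sum.inr ⟨(⟨F, hF⟩, k), hk⟩)
    have h4 := (pos_nat_mul_add_iff h1 h2 hg).2
    simp only [Sum.elim_inr] at h4
    rw [← h3, ← h3, map_add, map_add, map_smul, smul_eq_mul]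
    exact h4

end Duals

section ExpSeries

variable {s n : ℕ}

/-- The power series `exp (α + β X)`. -/
noncomputable def expSeries (α β : ℂ) : PowerSeries ℂ :=
  PowerSeries.C (Complex.exp α) * PowerSeries.rescale β (PowerSeries.exp ℂ)

theorem expSeries_add (α α' β β' : ℂ) :
    expSeries (α + α') (β + β') = expSeries α β * expSeries α' β' := by
  simp only [expSeries, ← PowerSeries.exp_mul_exp_eq_exp_add, Complex.exp_add, map_mul]
  ring

theorem expSeries_zero : expSeries 0 0 = 1 := by
  simp [expSeries]

theorem coeff_expSeries (α β : ℂ) (m : ℕ) :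
    PowerSeries.coeff m (expSeries α β) = Complex.exp α * (β ^ m / m.factorial) := by
  simp [expSeries, PowerSeries.coeff_exp, div_eq_mul_inv]

/-- The Laurent series valued character `y ↦ exp (A y + B y X)`. -/
noncomputable def expChar {G : Type*} [AddCommGroup G] (A B : G →+ ℂ) :
    AddChar G (LaurentSeries ℂ) where
  toFun y := (expSeries (A y) (B y) : PowerSeries ℂ)
  map_zero_eq_one' := by
    rw [map_zero, map_zero, expSeries_zero, PowerSeries.coe_one]
  map_add_eq_mul' x y := by
    rw [map_add, map_add, expSeries_add, PowerSeries.coe_mul]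

theorem expChar_apply {G : Type*} [AddCommGroup G] (A B : G →+ ℂ) (y : G) :
    expChar A B y = (expSeries (A y) (B y) : PowerSeries ℂ) := rfl

theorem coe_inv_of_constantCoeff_ne_zero {f : PowerSeries ℂ}
    (h : PowerSeries.constantCoeff f ≠ 0) :
    ((f : PowerSeries ℂ) : LaurentSeries ℂ)⁻¹ = (f⁻¹ : PowerSeries ℂ) := by
  refine inv_eq_of_mul_eq_one_right ?_
  rw [← PowerSeries.coe_mul, PowerSeries.mul_inv_cancel _ h, PowerSeries.coe_one]

open Classical in
/-- `1 / (1 - exp (α + β X))` has a pole of order at most one. -/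
theorem exists_inv_one_sub_expSeries (α β : ℂ)
    (h : ((expSeries α β : PowerSeries ℂ) : LaurentSeries ℂ) ≠ 1) :
    ∃ u : PowerSeries ℂ, (1 - ((expSeries α β : PowerSeries ℂ) : LaurentSeries ℂ))⁻¹ =
      (((PowerSeries.X : PowerSeries ℂ) : LaurentSeries ℂ) ^
        (if Complex.exp α = 1 then 1 else 0))⁻¹ * (u : LaurentSeries ℂ) := by
  rw [← PowerSeries.coe_one, ← PowerSeries.coe_sub]
  split_ifs with hα
  · have hβ : β ≠ 0 := by
      rintro rfl
      refine h ?_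
      simp [expSeries, hα]
    have hdvd : (PowerSeries.X : PowerSeries ℂ) ∣ 1 - expSeries α β := by
      rw [PowerSeries.X_dvd_iff, ← PowerSeries.coeff_zero_eq_constantCoeff_apply, map_sub,
        coeff_expSeries, hα]
      simp
    obtain ⟨v, hv⟩ := hdvd
    have hv0 : PowerSeries.constantCoeff v ≠ 0 := by
      have := congrArg (PowerSeries.coeff 1) hv
      rw [show 1 = 0 + 1 from rfl, PowerSeries.coeff_succ_X_mul, map_sub, coeff_expSeries, hα,
        PowerSeries.coeff_zero_eq_constantCoeff_apply] at this
      rw [← this]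
      simpa [PowerSeries.coeff_one] using hβ
    refine ⟨v⁻¹, ?_⟩
    rw [hv, PowerSeries.coe_mul, mul_inv, pow_one, coe_inv_of_constantCoeff_ne_zero hv0]
  · refine ⟨(1 - expSeries α β)⁻¹, ?_⟩
    rw [coe_inv_of_constantCoeff_ne_zero, pow_zero, inv_one, one_mul]
    rw [← PowerSeries.coeff_zero_eq_constantCoeff_apply, map_sub, coeff_expSeries]
    simpa [sub_eq_zero] using Ne.symm hα

open Classical in
theorem exists_prod_inv_one_sub_expSeries (T : Finset (Fin n)) (α β : Fin n → ℂ)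
    (h : ∀ i ∈ T, ((expSeries (α i) (β i) : PowerSeries ℂ) : LaurentSeries ℂ) ≠ 1) :
    ∃ u : PowerSeries ℂ,
      ∏ i ∈ T, (1 - ((expSeries (α i) (β i) : PowerSeries ℂ) : LaurentSeries ℂ))⁻¹ =
      (((PowerSeries.X : PowerSeries ℂ) : LaurentSeries ℂ) ^
        (T.filter fun i => Complex.exp (α i) = 1).card)⁻¹ * (u : LaurentSeries ℂ) := by
  choose! u hu using fun i (hi : i ∈ T) => exists_inv_one_sub_expSeries (α i) (β i) (h i hi)
  refine ⟨∏ i ∈ T, u i, ?_⟩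
  rw [Finset.prod_congr rfl hu, Finset.prod_mul_distrib, Finset.prod_inv_distrib,
    Finset.prod_pow_eq_pow_sum, ← Finset.card_filter]
  congr 1
  exact (map_prod (HahnSeries.ofPowerSeries ℤ ℂ) u T).symm

theorem coeff_zero_X_pow_inv_mul (N : ℕ) (f : PowerSeries ℂ) :
    ((((PowerSeries.X : PowerSeries ℂ) : LaurentSeries ℂ) ^ N)⁻¹ *
      (f : LaurentSeries ℂ)).coeff 0 = PowerSeries.coeff N f := by
  have h : (((PowerSeries.X : PowerSeries ℂ) : LaurentSeries ℂ) ^ N)⁻¹ =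
      HahnSeries.single (-(N : ℤ)) 1 := by
    rw [PowerSeries.coe_X, HahnSeries.single_pow]
    simp
  have h2 : (0 : ℤ) = (N : ℤ) + -(N : ℤ) := by simp
  rw [h, h2, HahnSeries.coeff_single_mul_add, one_mul, LaurentSeries.coeff_coe_powerSeries]

/-- The constant term of `c * exp (g (a + b X)) * u / X ^ N` is `exp a ^ g` times a polynomial
in `g` of degree at most `N`. -/
theorem exists_polynomial_coeff_expSeries (c a b : ℂ) (N : ℕ) (u : PowerSeries ℂ) :
    ∃ Q : Polynomial ℂ, Q.natDegree ≤ N ∧ ∀ g : ℕ,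
      (HahnSeries.C c * (((expSeries (g * a) (g * b) : PowerSeries ℂ) : LaurentSeries ℂ) *
        ((((PowerSeries.X : PowerSeries ℂ) : LaurentSeries ℂ) ^ N)⁻¹ *
          (u : LaurentSeries ℂ)))).coeff 0 = Complex.exp a ^ g * Q.eval (g : ℂ) := by
  refine ⟨∑ ij ∈ Finset.HasAntidiagonal.antidiagonal N, Polynomial.C (c * (b ^ ij.1 / ij.1.factorial *
    PowerSeries.coeff ij.2 u)) * Polynomial.X ^ ij.1, ?_, fun g => ?_⟩
  · refine Polynomial.natDegree_sum_le_of_forall_le _ _ fun ij hij => ?_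
    refine (Polynomial.natDegree_C_mul_X_pow_le _ _).trans ?_
    have := Finset.HasAntidiagonal.mem_antidiagonal.1 hij
    omega
  · rw [HahnSeries.C_mul_eq_smul, HahnSeries.coeff_smul, mul_left_comm, ← PowerSeries.coe_mul,
      coeff_zero_X_pow_inv_mul, PowerSeries.coeff_mul, Polynomial.eval_finsetSum, smul_eq_mul,
      Finset.mul_sum, Finset.mul_sum]
    refine Finset.sum_congr rfl fun ij _ => ?_
    rw [coeff_expSeries, Complex.exp_nat_mul, mul_pow]
    simp only [Polynomial.eval_mul, Polynomial.eval_C, Polynomial.eval_pow, Polynomial.eval_X]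
    ring

/-- Complex numbers without integer relations. -/
theorem exists_sum_intCast_mul_ne_zero (n : ℕ) :
    ∃ μ : Fin n → ℂ, ∀ a : Fin n → ℤ, a ≠ 0 → ∑ i, (a i : ℂ) * μ i ≠ 0 := by
  obtain ⟨v, hv⟩ : ∃ v : Fin n → ℝ, LinearIndependent ℚ v := by
    have h : (n : Cardinal) ≤ Module.rank ℚ ℝ := by
      rw [Real.rank_rat_real]
      exact (Cardinal.nat_lt_continuum n).le
    obtain ⟨t, ht, hli⟩ := le_rank_iff_exists_linearIndependent_finset.1 h
    exact ⟨_, hli.comp (t.equivFinOfCardEq ht).symm (Equiv.injective _)⟩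
  refine ⟨fun i => v i, fun a ha h => ha ?_⟩
  have h1 : ∑ i, (a i : ℚ) • v i = 0 := by
    have h2 : ((∑ i, (a i : ℝ) * v i : ℝ) : ℂ) = 0 := by
      push_cast
      exact h
    have h3 := Complex.ofReal_eq_zero.1 h2
    simpa [Rat.smul_def] using h3
  ext i
  have := Fintype.linearIndependent_iff.1 hv _ h1 i
  simpa using this

theorem coe_expSeries_ne_one {β : ℂ} (hβ : β ≠ 0) :
    ((expSeries 0 β : PowerSeries ℂ) : LaurentSeries ℂ) ≠ 1 := by
  intro h
  rw [← PowerSeries.coe_one] at h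
  have h2 := congrArg (PowerSeries.coeff 1) (HahnSeries.ofPowerSeries_injective h)
  rw [coeff_expSeries] at h2
  simp [PowerSeries.coeff_one] at h2
  exact hβ h2

theorem addChar_eq_prod {K : Type*} [Field K] (ψ : AddChar (Fin s → ℤ) K) (x : Fin s → ℤ) :
    ψ x = ∏ i, ψ (Pi.single i 1) ^ x i := by
  have h := addChar_mulVec (1 : Matrix (Fin s) (Fin s) ℤ) ψ x
  rw [Matrix.one_mulVec] at h
  rw [h]
  refine Finset.prod_congr rfl fun i _ => ?_
  congr 2
  ext l
  simp [Matrix.col, Matrix.one_apply, Pi.single_apply]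

/-- The functional `x ↦ ∑ i, x i * μ i`. -/
noncomputable def dotHom (μ : Fin n → ℂ) : (Fin n → ℤ) →+ ℂ where
  toFun x := ∑ i, (x i : ℂ) * μ i
  map_zero' := by simp
  map_add' x y := by simp [add_mul, Finset.sum_add_distrib]

theorem dotHom_apply (μ : Fin n → ℂ) (x : Fin n → ℤ) : dotHom μ x = ∑ i, (x i : ℂ) * μ i := rfl

theorem prod_expSeries_zpow (μ : Fin n → ℂ) (x : Fin n → ℤ) :
    ∏ i, ((expSeries 0 (μ i) : PowerSeries ℂ) : LaurentSeries ℂ) ^ x i =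
      (expSeries 0 (∑ i, (x i : ℂ) * μ i) : PowerSeries ℂ) := by
  have h := addChar_eq_prod (expChar 0 (dotHom μ)) x
  rw [expChar_apply, dotHom_apply] at h
  rw [AddMonoidHom.zero_apply] at h
  rw [h]
  refine Finset.prod_congr rfl fun i _ => ?_
  rw [expChar_apply, dotHom_apply]
  simp [Pi.single_apply]

end ExpSeries

section Characters

variable {s n : ℕ}

/-- The functional `y ↦ ∑ k, (ψ y) k * ν k`. -/
noncomputable def dualHom (ψ : Matrix (Fin n) (Fin s) ℤ) (ν : Fin n → ℂ) : (Fin s → ℤ) →+ ℂ :=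
  (dotHom ν).comp ψ.mulVecLin.toAddMonoidHom

theorem dualHom_apply (ψ : Matrix (Fin n) (Fin s) ℤ) (ν : Fin n → ℂ) (y : Fin s → ℤ) :
    dualHom ψ ν y = ∑ k, (ψ.mulVec y k : ℂ) * ν k := rfl

/-- The phases of the characters attached to a column basis. -/
noncomputable def phase (D : ℕ) (h : Fin n → ℕ) (k : Fin n) : ℂ :=
  h k * (2 * Real.pi * Complex.I) / D

theorem dualHom_col {M : Matrix (Fin s) (Fin n) ℤ} {F : Finset (Fin n)} {D : ℕ}
    {ψ : Matrix (Fin n) (Fin s) ℤ} (hψ : ∀ k ∉ F, ψ k = 0)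
    (hψM : ∀ k ∈ F, ∀ i ∈ F, (ψ * M) k i = if k = i then (D : ℤ) else 0) (ν : Fin n → ℂ)
    {i : Fin n} (hi : i ∈ F) : dualHom ψ ν (M.col i) = D * ν i := by
  have h : ∀ k, ψ.mulVec (M.col i) k = if k = i then (D : ℤ) else 0 := by
    intro k
    by_cases hk : k ∈ F
    · rw [← hψM k hk i hi]
      rfl
    · rw [if_neg (fun h : k = i => hk (h ▸ hi)), Matrix.mulVec, hψ k hk, zero_dotProduct]
  rw [dualHom_apply, Finset.sum_eq_single i]
  · rw [h, if_pos rfl]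
    simp
  · intro k _ hk
    rw [h, if_neg hk]
    simp
  · simp

theorem exp_mul_phase {D : ℕ} (hD : 0 < D) (h : Fin n → ℕ) (i : Fin n) :
    Complex.exp (D * phase D h i) = 1 := by
  have hD' : (D : ℂ) ≠ 0 := by exact_mod_cast hD.ne'
  rw [phase, mul_div_cancel₀ _ hD']
  exact Complex.exp_nat_mul_two_pi_mul_I _

/-- Orthogonality of the characters of the finite group attached to a column basis. -/
theorem sum_exp_dualHom_eq_zero {M : Matrix (Fin s) (Fin n) ℤ} {F : Finset (Fin n)} {D : ℕ}
    {ψ : Matrix (Fin n) (Fin s) ℤ} (hD : 0 < D) (hψ : ∀ k ∉ F, ψ k = 0)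
    (hMψ : M * ψ = (D : ℤ) • (1 : Matrix (Fin s) (Fin s) ℤ)) (y : Fin s → ℤ)
    (hy : ∀ x : Fin n → ℤ, (∀ i ∉ F, x i = 0) → M.mulVec x ≠ y) :
    ∑ h ∈ Fintype.piFinset (fun _ : Fin n => Finset.range D),
      Complex.exp (dualHom ψ (phase D h) y) = 0 := by
  have hD' : (D : ℂ) ≠ 0 := by exact_mod_cast hD.ne'
  obtain ⟨k, hk⟩ : ∃ k, ¬ (D : ℤ) ∣ ψ.mulVec y k := by
    by_contra! hdvd
    choose x hx using hdvd
    refine hy x (fun i hi => ?_) ?_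
    · have h1 := hx i
      rw [Matrix.mulVec, hψ i hi, zero_dotProduct] at h1
      simpa [hD.ne'] using h1.symm
    · have h1 : ψ.mulVec y = (D : ℤ) • x := funext hx
      have h2 := congrArg (fun A => Matrix.mulVec A y) hMψ
      simp only [← Matrix.mulVec_mulVec, h1, Matrix.mulVec_smul, Matrix.smul_mulVec,
        Matrix.one_mulVec] at h2
      ext l
      have h3 := congrFun h2 l
      simp only [Pi.smul_apply, smul_eq_mul] at h3
      exact mul_left_cancel₀ (by exact_mod_cast hD.ne') h3
  let z : Fin n → ℂ := fun k =>
    Complex.exp ((ψ.mulVec y k : ℂ) * ((2 * Real.pi * Complex.I) / D))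
  have hexp : ∀ h : Fin n → ℕ,
      Complex.exp (dualHom ψ (phase D h) y) = ∏ k, z k ^ h k := by
    intro h
    rw [dualHom_apply, Complex.exp_sum]
    refine Finset.prod_congr rfl fun k _ => ?_
    rw [← Complex.exp_nat_mul, phase]
    congr 1
    ring
  simp only [hexp]
  rw [← Finset.prod_univ_sum (fun _ : Fin n => Finset.range D) (fun k j => z k ^ j)]
  refine Finset.prod_eq_zero (Finset.mem_univ k) ?_
  have hz1 : z k ≠ 1 := by
    intro h
    obtain ⟨m, hm⟩ := Complex.exp_eq_one_iff.1 h
    refine hk ⟨m, ?_⟩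
    have h2 := Complex.two_pi_I_ne_zero
    rw [← mul_div_assoc, div_eq_iff hD', mul_right_comm (m : ℂ)] at hm
    have h3 := mul_right_cancel₀ h2 hm
    have h4 : ψ.mulVec y k = m * D := by exact_mod_cast h3
    rw [h4, mul_comm]
  have hzD : z k ^ D = 1 := by
    rw [← Complex.exp_nat_mul, mul_left_comm, mul_div_cancel₀ _ hD']
    exact Complex.exp_int_mul_two_pi_mul_I _
  rw [geom_sum_eq hz1, hzD]
  simp

theorem coe_expSeries_inv (α β : ℂ) :
    ((expSeries α β : PowerSeries ℂ) : LaurentSeries ℂ)⁻¹ =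
      (expSeries (-α) (-β) : PowerSeries ℂ) := by
  refine inv_eq_of_mul_eq_one_right ?_
  rw [← PowerSeries.coe_mul, ← expSeries_add, add_neg_cancel, add_neg_cancel, expSeries_zero,
    PowerSeries.coe_one]

open Classical in
/-- The constant term of the contribution of one character to a vertex is an exponential
polynomial in the dilation factor. -/
theorem exists_polynomial_vertex_coeff (M : Matrix (Fin s) (Fin n) ℤ) (F : Finset (Fin n))
    (μ : Fin n → ℂ) (A B : (Fin s → ℤ) →+ ℂ) (c : ℂ) (b : Fin s → ℤ)
    (h : ∀ i ∉ F, ((expSeries 0 (μ i) : PowerSeries ℂ) : LaurentSeries ℂ) /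
      expChar A B (M.col i) ≠ 1) :
    ∃ Q : Polynomial ℂ,
      Q.natDegree ≤ ((Finset.univ \ F).filter fun i => Complex.exp (A (M.col i)) = 1).card ∧
      ∀ g : ℕ, (HahnSeries.C c * (expChar A B ((g : ℤ) • b) * ∏ i ∈ Finset.univ \ F,
        (1 - ((expSeries 0 (μ i) : PowerSeries ℂ) : LaurentSeries ℂ) /
          expChar A B (M.col i))⁻¹)).coeff 0 = Complex.exp (A b) ^ g * Q.eval (g : ℂ) := by
  have hdiv : ∀ i, ((expSeries 0 (μ i) : PowerSeries ℂ) : LaurentSeries ℂ) /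
      expChar A B (M.col i) =
      (expSeries (-(A (M.col i))) (μ i + -(B (M.col i))) : PowerSeries ℂ) := by
    intro i
    rw [expChar_apply, div_eq_mul_inv, coe_expSeries_inv, ← PowerSeries.coe_mul,
      ← expSeries_add, zero_add]
  simp only [hdiv] at h ⊢
  obtain ⟨u, hu⟩ := exists_prod_inv_one_sub_expSeries (Finset.univ \ F)
    (fun i => -(A (M.col i))) (fun i => μ i + -(B (M.col i)))
    (fun i hi => h i (Finset.mem_sdiff.1 hi).2)
  rw [hu]
  simp only [Complex.exp_neg, inv_eq_one]
  obtain ⟨Q, hQ, hQ'⟩ := exists_polynomial_coeff_expSeries c (A b) (B b)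
    ((Finset.univ \ F).filter fun i => Complex.exp (A (M.col i)) = 1).card u
  refine ⟨Q, hQ, fun g => ?_⟩
  rw [← hQ' g, expChar_apply, map_zsmul, map_zsmul]
  simp

/-- The point of the torus attached to a functional. -/
noncomputable def torusPoint (A : (Fin s → ℤ) →+ ℂ) : Fin s → ℂ :=
  fun i => Complex.exp (A (Pi.single i 1))

theorem charP_torusPoint (A : (Fin s → ℤ) →+ ℂ) (y : Fin s → ℤ) :
    charP s (torusPoint A) y = Complex.exp (A y) := by
  let ψ : AddChar (Fin s → ℤ) ℂ :=
    { toFun := fun y => Complex.exp (A y)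
      map_zero_eq_one' := by simp
      map_add_eq_mul' := fun x y => by rw [map_add, Complex.exp_add] }
  exact (addChar_eq_prod ψ y).symm

theorem torusPoint_mem_Aset {M : Matrix (Fin s) (Fin n) ℤ} {F : Finset (Fin n)}
    (hF : IsColBasis M F) (A : (Fin s → ℤ) →+ ℂ)
    (hA : ∀ i ∈ F, Complex.exp (A (M.col i)) = 1) : torusPoint A ∈ Aset s n M := by
  refine ⟨fun i => Complex.exp_ne_zero _, ?_⟩
  rw [eq_top_iff, ← hF.1]
  refine Submodule.span_mono (Set.image_mono fun j hj => ?_)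
  exact (charP_torusPoint A (M.col j)).trans (hA j hj)

open Classical in
theorem card_filter_eq_card_idxSet_sub {M : Matrix (Fin s) (Fin n) ℤ} {F : Finset (Fin n)}
    (hF : IsColBasis M F) (A : (Fin s → ℤ) →+ ℂ)
    (hA : ∀ i ∈ F, Complex.exp (A (M.col i)) = 1) :
    ((Finset.univ \ F).filter fun i => Complex.exp (A (M.col i)) = 1).card =
      (idxSet s n M (torusPoint A)).card - s := by
  have hmem : ∀ j, j ∈ idxSet s n M (torusPoint A) ↔ Complex.exp (A (M.col j)) = 1 := by
    intro j
    rw [← charP_torusPoint]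
    simp only [idxSet, Set.Finite.mem_toFinset, Set.mem_ofPred_eq]
    rfl
  have hcard := Finset.card_sdiff_of_subset
    (show F ⊆ idxSet s n M (torusPoint A) from fun j hj => (hmem j).2 (hA j hj))
  rw [hF.2] at hcard
  rw [← hcard]
  congr 1
  ext j
  simp [hmem, and_comm]

theorem coeff_zero_weightedCount (M : Matrix (Fin s) (Fin n) ℤ)
    (hM : ∃ f : (Fin s → ℝ) →ₗ[ℝ] ℝ, ∀ j, 0 < f (col s n M j)) (μ : Fin n → ℂ)
    (y : Fin s → ℤ) :
    (weightedCount M (fun i => ((expSeries 0 (μ i) : PowerSeries ℂ) : LaurentSeries ℂ))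
      Finset.univ 0 y).coeff 0 = Nat.card (fiberPts M Finset.univ 0 y) := by
  have hfin := finite_fiberPts M hM Finset.univ 0 y
  rw [weightedCount, finsum_mem_eq_finite_toFinset_sum _ hfin, HahnSeries.coeff_sum,
    Nat.card_coe_set_eq, Set.ncard_eq_toFinset_card _ hfin, Finset.card_eq_sum_ones,
    Nat.cast_sum]
  refine Finset.sum_congr rfl fun x _ => ?_
  rw [prod_expSeries_zpow]
  have h := LaurentSeries.coeff_coe_powerSeries (expSeries 0 (∑ i, (x i : ℂ) * μ i)) 0
  rw [coeff_expSeries] at h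
  simpa using h

/-- Lattice points of the dilate `g P` are the points of a fibre of `M`. -/
theorem card_lattice_points_dilate (M : Matrix (Fin s) (Fin n) ℤ) (b : Fin s → ℤ) (g : ℕ)
    (hg : 0 < g) :
    Nat.card {x : Fin n → ℝ // x ∈ (g : ℝ) • {x : Fin n → ℝ | (∀ j, 0 ≤ x j) ∧
      ∀ i, ∑ j, (M i j : ℝ) * x j = (b i : ℝ)} ∧ ∀ j, ∃ z : ℤ, x j = (z : ℝ)} =
      Nat.card (fiberPts M Finset.univ 0 ((g : ℤ) • b)) := by
  have hg' : (0 : ℝ) < g := by exact_mod_cast hg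
  have key : ∀ x : Fin n → ℝ, x ∈ (g : ℝ) • {x : Fin n → ℝ | (∀ j, 0 ≤ x j) ∧
      ∀ i, ∑ j, (M i j : ℝ) * x j = (b i : ℝ)} ↔
      (∀ j, 0 ≤ x j) ∧ ∀ i, ∑ j, (M i j : ℝ) * x j = g * b i := by
    intro x
    rw [Set.mem_smul_set_iff_inv_smul_mem₀ hg'.ne']
    simp only [Set.mem_ofPred_eq, Pi.smul_apply, smul_eq_mul]
    refine and_congr (forall_congr' fun j => ?_) (forall_congr' fun i => ?_)
    · exact mul_nonneg_iff_of_pos_left (inv_pos.2 hg')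
    · simp only [mul_left_comm _ (g : ℝ)⁻¹, ← Finset.mul_sum]
      rw [inv_mul_eq_iff_eq_mul₀ hg'.ne']
  have key2 : ∀ z : Fin n → ℤ, z ∈ fiberPts M Finset.univ 0 ((g : ℤ) • b) ↔
      (∀ j, 0 ≤ (z j : ℝ)) ∧ ∀ i, ∑ j, (M i j : ℝ) * z j = g * b i := by
    intro z
    simp only [fiberPts, Set.mem_ofPred_eq, Finset.mem_univ, forall_true_left, not_true_eq_false,
      false_imp_iff, implies_true, and_true, Pi.zero_apply, Int.cast_nonneg_iff, funext_iff,
      Matrix.mulVec, dotProduct, Pi.smul_apply, smul_eq_mul]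
    rw [and_comm]
    refine and_congr_right fun _ => forall_congr' fun i => ?_
    constructor
    · intro h
      exact_mod_cast h
    · intro h
      exact_mod_cast h
  refine (Nat.card_congr (Equiv.ofBijective
    (fun z : fiberPts M Finset.univ 0 ((g : ℤ) • b) =>
      (⟨fun j => ((z.1 j : ℤ) : ℝ), (key _).2 ((key2 _).1 z.2), fun j => ⟨_, rfl⟩⟩ :
        {x : Fin n → ℝ // x ∈ (g : ℝ) • {x : Fin n → ℝ | (∀ j, 0 ≤ x j) ∧
          ∀ i, ∑ j, (M i j : ℝ) * x j = (b i : ℝ)} ∧ ∀ j, ∃ z : ℤ, x j = (z : ℝ)}))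
      ⟨fun z z' h => ?_, fun x => ?_⟩)).symm
  · ext j
    have := congrFun (congrArg Subtype.val h) j
    exact Int.cast_injective this
  · obtain ⟨x, hx, hz⟩ := x
    obtain ⟨z, hz'⟩ := Classical.skolem.1 hz
    obtain rfl : x = fun j => (z j : ℝ) := funext hz'
    exact ⟨⟨z, (key2 z).2 ((key _).1 hx)⟩, rfl⟩

/-- Exponential polynomials with bases indexed by a finite family collect into one polynomial
for each base point. -/
theorem exists_collect_polynomials {κ X : Type*} (T : Finset κ) (θ : κ → X) (S : Set X)
    (hθ : ∀ t ∈ T, θ t ∈ S) (c : X → ℂ) (Q : κ → Polynomial ℂ) (d : X → ℕ)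
    (hQ : ∀ t ∈ T, (Q t).natDegree ≤ d (θ t)) :
    ∃ q : X → Polynomial ℂ, (∀ x, (q x).natDegree ≤ d x) ∧ ∀ g : ℕ,
      ∑ t ∈ T, c (θ t) ^ g * (Q t).eval (g : ℂ) =
        ∑ᶠ x ∈ S, c x ^ g * (q x).eval (g : ℂ) := by
  classical
  refine ⟨fun x => ∑ t ∈ T.filter (fun t => θ t = x), Q t, fun x => ?_, fun g => ?_⟩
  · refine Polynomial.natDegree_sum_le_of_forall_le _ _ fun t ht => ?_
    obtain ⟨h1, rfl⟩ := Finset.mem_filter.1 ht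
    exact hQ t h1
  · have hsub : ∀ x, x ∉ T.image θ → ∑ t ∈ T.filter (fun t => θ t = x), Q t = 0 := by
      intro x hx
      refine Finset.sum_eq_zero fun t ht => ?_
      obtain ⟨h1, rfl⟩ := Finset.mem_filter.1 ht
      exact absurd (Finset.mem_image_of_mem θ h1) hx
    rw [finsum_mem_eq_sum_of_inter_support_eq (t := T.image θ)]
    · rw [← Finset.sum_fiberwise_of_maps_to (fun t ht => Finset.mem_image_of_mem θ ht)]
      refine Finset.sum_congr rfl fun x _ => ?_
      rw [Polynomial.eval_finsetSum, Finset.mul_sum]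
      refine Finset.sum_congr rfl fun t ht => ?_
      rw [(Finset.mem_filter.1 ht).2]
    · ext x
      simp only [Set.mem_inter_iff, Function.mem_support]
      refine and_congr_left fun hx => ?_
      have hx' : x ∈ T.image θ := by
        by_contra h
        exact hx (by rw [hsub x h]; simp)
      refine ⟨fun _ => hx', fun _ => ?_⟩
      obtain ⟨t, ht, rfl⟩ := Finset.mem_image.1 hx'
      exact hθ t ht

end Characters

/-- **Explicit form of the Ehrhart quasi-polynomial.**  For `P = {x ≥ 0 : Mx = b}` with
`b ∈ ℤˢ ∩ closure(Ω)`, there are polynomials `q_θ` of degree at most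
`n - s - κ_θ` (`κ_θ = n - #M_θ`) such that for every positive integer `g`,
`#(gP ∩ ℤⁿ) = ∑_{θ ∈ A(M)} (θ^b)^g q_θ(g)`. -/
theorem ehrhart_quasi_polynomial (s n : ℕ) (hs : 1 ≤ s) (hn : s ≤ n)
    (M : Matrix (Fin s) (Fin n) ℤ)
    (hspan : Submodule.span ℝ (Set.range (col s n M)) = ⊤)
    (hhull : (0 : Fin s → ℝ) ∉ convexHull ℝ (Set.range (col s n M)))
    (Ω : Set (Fin s → ℝ)) (hΩ : IsFundCone s n M Ω)
    (b : Fin s → ℤ) (hb : (fun i => (b i : ℝ)) ∈ closure Ω)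
    (P : Set (Fin n → ℝ))
    (hP : P = {x | (∀ j, 0 ≤ x j) ∧ ∀ i, ∑ j, (M i j : ℝ) * x j = (b i : ℝ)}) :
    ∃ q : (Fin s → ℂ) → Polynomial ℂ,
      (∀ θ ∈ Aset s n M, (q θ).natDegree ≤ (idxSet s n M θ).card - s) ∧
      ∀ g : ℕ, 0 < g →
        (Nat.card {x : Fin n → ℝ //
            x ∈ (g : ℝ) • P ∧ ∀ j, ∃ z : ℤ, x j = (z : ℝ)} : ℂ) =
          ∑ᶠ θ ∈ Aset s n M, (charP s θ b) ^ g * (q θ).eval (g : ℂ) := by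
  classical
  obtain ⟨μ, hμ⟩ := exists_sum_intCast_mul_ne_zero n
  have hM := exists_pos_functional M hhull
  obtain ⟨η, hη, hgen_η⟩ := exists_generic_offset M hspan (fun i => (b i : ℝ))
  choose! D ψ hD hψ hψM hMψ using fun F (hF : IsColBasis M F) => hF.exists_dual
  let w : Fin n → LaurentSeries ℂ := fun i => (expSeries 0 (μ i) : PowerSeries ℂ)
  have hgen : ∀ a : Fin n → ℤ, M.mulVec a = 0 → a ≠ 0 → ∏ i, w i ^ a i ≠ 1 := by
    intro a _ ha
    rw [prod_expSeries_zpow]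
    exact coe_expSeries_ne_one (hμ a ha)
  have hw : ∀ i, w i ≠ 0 := by
    intro i h
    have h1 := prod_expSeries_zpow μ (Pi.single i 1)
    rw [Finset.prod_eq_zero (Finset.mem_univ i) (by simpa using h)] at h1
    have h2 := congrArg (PowerSeries.coeff 0)
      (HahnSeries.ofPowerSeries_injective ((map_zero (HahnSeries.ofPowerSeries ℤ ℂ)).trans h1))
    rw [coeff_expSeries] at h2
    simp at h2
  let H : Finset (Fin n) → Finset (Fin n → ℕ) := fun F =>
    Fintype.piFinset fun _ => Finset.range (D F)
  let A : Finset (Fin n) → (Fin n → ℕ) → (Fin s → ℤ) →+ ℂ := fun F h =>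
    dualHom (ψ F) (phase (D F) h)
  let B : Finset (Fin n) → (Fin s → ℤ) →+ ℂ := fun F => dualHom (ψ F) fun k => μ k / D F
  let χ : Finset (Fin n) → (Fin n → ℕ) → AddChar (Fin s → ℤ) (LaurentSeries ℂ) := fun F h =>
    expChar (A F h) (B F)
  have hA : ∀ F, IsColBasis M F → ∀ h, ∀ i ∈ F, Complex.exp (A F h (M.col i)) = 1 := by
    intro F hF h i hi
    rw [dualHom_col (hψ F hF) (hψM F hF) _ hi]
    exact exp_mul_phase (hD F hF) h i
  have hχ : ∀ F, IsColBasis M F → ∀ h ∈ H F, ∀ i ∈ F, χ F h (M.col i) = w i := by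
    intro F hF h _ i hi
    have hD' : (D F : ℂ) ≠ 0 := by exact_mod_cast (hD F hF).ne'
    simp only [χ, w, expChar_apply]
    congr 1
    rw [expSeries, hA F hF h i hi, dualHom_col (hψ F hF) (hψM F hF) _ hi,
      mul_div_cancel₀ _ hD', expSeries, Complex.exp_zero]
  have hcard0 : ∀ F, IsColBasis M F → (H F).card ≠ 0 := by
    intro F hF
    simp [H, (hD F hF).ne']
  have hcard : ∀ F, IsColBasis M F → ((H F).card : LaurentSeries ℂ) ≠ 0 := by
    intro F hF h
    have h1 : HahnSeries.C (((H F).card : ℕ) : ℂ) = (0 : LaurentSeries ℂ) := by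
      rw [map_natCast]
      exact h
    have h2 := HahnSeries.C_injective (h1.trans (map_zero HahnSeries.C).symm)
    exact hcard0 F hF (by exact_mod_cast h2)
  have hzero : ∀ F, IsColBasis M F → ∀ y : Fin s → ℤ,
      (∀ x : Fin n → ℤ, (∀ i ∉ F, x i = 0) → M.mulVec x ≠ y) → ∑ h ∈ H F, χ F h y = 0 := by
    intro F hF y hy
    have h1 := sum_exp_dualHom_eq_zero (hD F hF) (hψ F hF) (hMψ F hF) y hy
    simp only [χ, expChar_apply, expSeries, PowerSeries.coe_mul, PowerSeries.coe_C]
    rw [← Finset.sum_mul, ← map_sum, h1, map_zero, zero_mul]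
  let p : Fin s → ℝ := (fun i => (b i : ℝ)) + ∑ j, η j • col s n M j
  let V : Finset (Finset (Fin n)) :=
    Finset.univ.filter fun F => IsColBasis M F ∧ PosOn M p F
  have hQ : ∀ F h, ∃ Q : Polynomial ℂ, IsColBasis M F → h ∈ H F →
      Q.natDegree ≤ (idxSet s n M (torusPoint (A F h))).card - s ∧
      ∀ g : ℕ, (HahnSeries.C (((H F).card : ℂ)⁻¹) * (χ F h ((g : ℤ) • b) *
        ∏ i ∈ Finset.univ \ F, (1 - w i / χ F h (M.col i))⁻¹)).coeff 0 =
        charP s (torusPoint (A F h)) b ^ g * Q.eval (g : ℂ) := by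
    intro F h
    by_cases hF : IsColBasis M F
    swap
    · exact ⟨0, fun h => absurd h hF⟩
    by_cases hh : h ∈ H F
    swap
    · exact ⟨0, fun _ h => absurd h hh⟩
    obtain ⟨Q, h1, h2⟩ := exists_polynomial_vertex_coeff M F μ (A F h) (B F)
      (((H F).card : ℂ)⁻¹) b fun i hi =>
        div_addChar_ne_one M w hgen F hF (χ F h) (hχ F hF h hh) i hi
    refine ⟨Q, fun _ _ => ⟨?_, fun g => ?_⟩⟩
    · rw [← card_filter_eq_card_idxSet_sub hF (A F h) (hA F hF h)]
      exact h1
    · rw [charP_torusPoint, ← h2 g]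
  choose Q hQ using hQ
  have hT : ∀ t ∈ V.sigma H, IsColBasis M t.1 ∧ t.2 ∈ H t.1 := by
    intro t ht
    rw [Finset.mem_sigma] at ht
    exact ⟨(Finset.mem_filter.1 ht.1).2.1, ht.2⟩
  obtain ⟨q, hq, hq'⟩ := exists_collect_polynomials (V.sigma H)
    (fun t => torusPoint (A t.1 t.2)) (Aset s n M)
    (fun t ht => torusPoint_mem_Aset (hT t ht).1 _ (hA t.1 (hT t ht).1 t.2))
    (fun θ => charP s θ b) (fun t => Q t.1 t.2) (fun θ => (idxSet s n M θ).card - s)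
    (fun t ht => (hQ t.1 t.2 (hT t ht).1 (hT t ht).2).1)
  refine ⟨q, fun θ _ => hq θ, fun g hg => ?_⟩
  obtain ⟨hp, hpos⟩ := hgen_η g hg
  have hcount := weightedCount_eq_vertexSum M hM w hw hgen H χ hχ hcard hzero _ hp
    ((g : ℤ) • b) Finset.univ η 0 (by
      congr 1
      ext i
      simp) (fun i _ => by simpa using hη i) (fun i hi => absurd (Finset.mem_univ i) hi)
  have hcount0 := congrArg (fun f : LaurentSeries ℂ => f.coeff 0) hcount
  simp only [w] at hcount0
  rw [coeff_zero_weightedCount M hM μ, ← card_lattice_points_dilate M b g hg, ← hP] at hcount0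
  rw [hcount0, ← hq' g, Finset.sum_sigma, vertexSum, HahnSeries.coeff_sum, Finset.sum_filter]
  refine Finset.sum_congr rfl fun F _ => ?_
  by_cases hF : IsColBasis M F
  swap
  · simp [hF]
  by_cases hFp : PosOn M p F
  swap
  · rw [if_neg fun h => hFp ((hpos F hF).1 h.2.2), if_neg fun h => hFp h.2, HahnSeries.coeff_zero]
  rw [if_pos ⟨Finset.subset_univ F, hF, (hpos F hF).2 hFp⟩, if_pos ⟨hF, hFp⟩, vertexTerm,
    Finset.mul_sum, HahnSeries.coeff_sum]
  refine Finset.sum_congr rfl fun h hh => ?_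
  rw [← (hQ F h hF hh).2 g, map_inv₀, map_natCast]
  simp [w]
end

section
/- Let M be an s×n integer matrix (n ≥ s ≥ 1) whose columns span ℝˢ and whose convex hull does not contain the origin, and let Ω be a fundamental M-cone. Then there exists a homogeneous polynomial p of degree n−s on ℝˢ with D_Y p = 0 for all Y ∈ 𝒴(M), such that T(x|M) = p(x) for all x ∈ Ω. -/
open MeasureTheory Matrix
open scoped ENNReal

/-- The iterated directional-derivative operator `D_Y = ∏_{y ∈ Y} D_y`, applied along a
list of direction vectors (`D_y f = ∑_j y_j ∂_j f`). -/
noncomputable def DY {F : Type*} [NormedAddCommGroup F] [NormedSpace ℝ F]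
    (s : ℕ) (l : List (Fin s → ℝ)) (f : (Fin s → ℝ) → F) : (Fin s → ℝ) → F :=
  l.foldr (fun y g => fun x => fderiv ℝ g x y) f

/-- The multivariate truncated power `T(x|M)`: the `(n-s)`-dimensional Hausdorff
measure of `{y ≥ 0 : My = x}` divided by `√(det (M Mᵀ))`, as a real number. -/
noncomputable def Tfull (s n : ℕ) (M : Matrix (Fin s) (Fin n) ℤ) (x : Fin s → ℝ) : ℝ :=
  ((μH[((n : ℝ) - (s : ℝ))] {y : EuclideanSpace ℝ (Fin n) | (∀ j, 0 ≤ y j) ∧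
      ∀ i, ∑ j, (M i j : ℝ) * y j = x i}) /
    ENNReal.ofReal (Real.sqrt
      ((M.map (Int.cast : ℤ → ℝ) * (M.map (Int.cast : ℤ → ℝ))ᵀ).det))).toReal


section Fibers

open scoped Topology Pointwise NNReal
open Module

variable {ι E : Type*} [Fintype ι] [AddCommGroup E] [Module ℝ E]

/-- The linear combination of the vectors `v j` with coefficients the coordinates of `y`. -/
noncomputable def comb (v : ι → E) : EuclideanSpace ℝ ι →ₗ[ℝ] E :=
  ∑ j, (EuclideanSpace.projₗ j : EuclideanSpace ℝ ι →ₗ[ℝ] ℝ).smulRight (v j)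

lemma comb_apply (v : ι → E) (y : EuclideanSpace ℝ ι) : comb v y = ∑ j, y j • v j := by
  simp [comb]

/-- Nonnegative coefficient vectors supported in `J` that represent `x`. -/
def fiber (v : ι → E) (J : Finset ι) (x : E) : Set (EuclideanSpace ℝ ι) :=
  {y | (∀ j, 0 ≤ y j) ∧ (∀ j ∉ J, y j = 0) ∧ comb v y = x}

/-- Linear relations among the vectors `v j`, `j ∈ J`. -/
noncomputable def relations (v : ι → E) (J : Finset ι) : Submodule ℝ (EuclideanSpace ℝ ι) where
  carrier := {k | (∀ j ∉ J, k j = 0) ∧ comb v k = 0}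
  add_mem' := by
    rintro a b ⟨ha, ha'⟩ ⟨hb, hb'⟩
    exact ⟨fun j hj => by simp [ha j hj, hb j hj], by simp [ha', hb']⟩
  zero_mem' := by simp
  smul_mem' := by
    rintro c a ⟨ha, ha'⟩
    exact ⟨fun j hj => by simp [ha j hj], by simp [ha']⟩

lemma mem_relations {v : ι → E} {J : Finset ι} {k : EuclideanSpace ℝ ι} :
    k ∈ relations v J ↔ (∀ j ∉ J, k j = 0) ∧ comb v k = 0 := Iff.rfl

lemma comb_single [DecidableEq ι] (v : ι → E) (j : ι) (t : ℝ) :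
    comb v (EuclideanSpace.single j t) = t • v j := by
  rw [comb_apply, Finset.sum_eq_single j]
  · simp
  · intro b _ hb; simp [hb]
  · simp

/-- A linear choice of coefficients supported in a spanning subfamily. -/
lemma exists_linear_section {v : ι → E} {J : Finset ι}
    (hJ : Submodule.span ℝ (v '' J) = ⊤) :
    ∃ r : E →ₗ[ℝ] EuclideanSpace ℝ ι,
      (∀ x, ∀ j ∉ J, r x j = 0) ∧ ∀ x, comb v (r x) = x := by
  classical
  let P : EuclideanSpace ℝ ι →ₗ[ℝ] EuclideanSpace ℝ ι :=
    { toFun := fun y => WithLp.toLp 2 fun j => if j ∈ J then y j else 0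
      map_add' := by intro a b; ext j; by_cases h : j ∈ J <;> simp [h]
      map_smul' := by intro a b; ext j; by_cases h : j ∈ J <;> simp [h] }
  have hr : (comb v ∘ₗ P).range = ⊤ := by
    rw [eq_top_iff, ← hJ, Submodule.span_le]
    rintro _ ⟨j, hj, rfl⟩
    refine ⟨EuclideanSpace.single j 1, ?_⟩
    have : P (EuclideanSpace.single j 1) = EuclideanSpace.single j 1 := by
      ext i
      by_cases h : i = j
      · subst h; simpa [P] using hj
      · simp [P, h]
    rw [LinearMap.comp_apply, this, comb_single, one_smul]
  obtain ⟨g, hg⟩ := LinearMap.exists_rightInverse_of_surjective _ hr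
  refine ⟨P ∘ₗ g, fun x j hj => by simp [P, hj], fun x => ?_⟩
  exact LinearMap.congr_fun hg x

/-- Under an injective linear map from a `d`-dimensional space, `d`-dimensional Hausdorff measure
pulls back to a Haar measure. -/
lemma isAddHaarMeasure_comap_hausdorffMeasure {V W : Type*}
    [NormedAddCommGroup V] [NormedSpace ℝ V] [FiniteDimensional ℝ V] [MeasurableSpace V]
    [BorelSpace V] [NormedAddCommGroup W] [NormedSpace ℝ W] [MeasurableSpace W] [BorelSpace W]
    (L : V →ₗ[ℝ] W) (hL : L.ker = ⊥) {d : ℝ} (hd : d = finrank ℝ V) :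
    ((μH[d] : Measure W).comap L).IsAddHaarMeasure := by
  subst hd
  have hemb := (LinearMap.isClosedEmbedding_of_injective hL).measurableEmbedding
  have hd0 : (0 : ℝ) ≤ finrank ℝ V := Nat.cast_nonneg _
  have hinv : ((μH[(finrank ℝ V : ℝ)] : Measure W).comap L).IsAddLeftInvariant := by
    refine ⟨fun g => ?_⟩
    ext s hs
    rw [Measure.map_apply (measurable_const_add g) hs, hemb.comap_apply, hemb.comap_apply,
      ← hausdorffMeasure_vadd (L g) (Or.inl hd0) (L '' ((g + ·) ⁻¹' s))]
    congr 1
    ext w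
    simp only [Set.mem_vadd_set, Set.mem_image, Set.mem_preimage, vadd_eq_add]
    constructor
    · rintro ⟨_, ⟨a, ha, rfl⟩, rfl⟩
      exact ⟨g + a, ha, map_add _ _ _⟩
    · rintro ⟨a, ha, rfl⟩
      exact ⟨L (-g + a), ⟨-g + a, by simpa using ha, rfl⟩, by simp⟩
  obtain ⟨K, -, hK⟩ := LinearMap.exists_antilipschitzWith L hL
  have hlip := L.toContinuousLinearMap.lipschitz
  have hball : IsCompact (Metric.closedBall (0 : V) 1) := isCompact_closedBall 0 1
  have hinterior : (interior (Metric.closedBall (0 : V) 1)).Nonempty :=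
    ⟨0, Metric.ball_subset_interior_closedBall (by simp)⟩
  refine Measure.isAddHaarMeasure_of_isCompact_nonempty_interior _ _ hball hinterior ?_ ?_
  · rw [hemb.comap_apply]
    intro h0
    have h1 := hK.le_hausdorffMeasure_image hd0 (Metric.closedBall (0 : V) 1)
    rw [h0, mul_zero] at h1
    exact (Measure.measure_pos_of_nonempty_interior _ hinterior).ne' (le_antisymm h1 zero_le)
  · rw [hemb.comap_apply]
    refine ne_top_of_le_ne_top ?_ (hlip.hausdorffMeasure_image_le hd0 _)
    exact ENNReal.mul_ne_top (ENNReal.rpow_ne_top_of_nonneg hd0 ENNReal.coe_ne_top)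
      hball.measure_lt_top.ne

/-- The Haar measure on the space of relations induced by Hausdorff measure. -/
noncomputable def relMeasure (v : ι → E) (J : Finset ι) : Measure (relations v J) :=
  (μH[(finrank ℝ (relations v J) : ℝ)]).comap (relations v J).subtype

instance (v : ι → E) (J : Finset ι) : (relMeasure v J).IsAddHaarMeasure :=
  isAddHaarMeasure_comap_hausdorffMeasure _ (Submodule.ker_subtype _) rfl

/-- The volume of a fiber, before converting to a real number. -/
noncomputable def fiberVol (v : ι → E) (J : Finset ι) (x : E) : ℝ≥0∞ :=
  μH[(finrank ℝ (relations v J) : ℝ)] (fiber v J x)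

lemma relMeasure_translate {v : ι → E} {J : Finset ι} {z : EuclideanSpace ℝ ι}
    (hz : ∀ j ∉ J, z j = 0) :
    relMeasure v J {k | ∀ j, 0 ≤ (k : EuclideanSpace ℝ ι) j + z j} =
      fiberVol v J (comb v z) := by
  have hemb := (LinearMap.isClosedEmbedding_of_injective
    (Submodule.ker_subtype (relations v J))).measurableEmbedding
  rw [relMeasure, hemb.comap_apply, fiberVol,
    ← hausdorffMeasure_vadd z (Or.inl (Nat.cast_nonneg _))]
  congr 1
  ext y
  simp only [Set.mem_vadd_set, Set.mem_image, Set.mem_ofPred_eq, vadd_eq_add]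
  constructor
  · rintro ⟨_, ⟨k, hk, rfl⟩, rfl⟩
    obtain ⟨h1, h2⟩ := mem_relations.1 k.2
    refine ⟨fun j => ?_, fun j hj => ?_, ?_⟩
    · simpa [add_comm] using hk j
    · simp [hz j hj, h1 j hj]
    · simp [h2]
  · rintro ⟨h1, h2, h3⟩
    refine ⟨y - z, ⟨⟨y - z, ?_⟩, ?_, rfl⟩, by simp⟩
    · exact mem_relations.2 ⟨fun j hj => by simp [h2 j hj, hz j hj], by simp [h3]⟩
    · intro j; simpa using h1 j

/-- Deleting a vector whose complement still spans: the volume of a fiber is a multiple of the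
integral of the volumes of its slices. -/
lemma exists_fiberVol_eq_lintegral [DecidableEq ι] {v : ι → E} {J : Finset ι} {j : ι} (hj : j ∈ J)
    (hJ : Submodule.span ℝ (v '' (J.erase j : Finset ι)) = ⊤) :
    finrank ℝ (relations v J) = finrank ℝ (relations v (J.erase j)) + 1 ∧
    (∀ x, Measurable fun t : ℝ => fiberVol v (J.erase j) (x - t • v j)) ∧
    ∃ c : ℝ≥0, 0 < c ∧ ∀ x, fiberVol v J x =
      c * ∫⁻ t in Set.Ici (0 : ℝ), fiberVol v (J.erase j) (x - t • v j) := by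
  obtain ⟨r, hr, hrv⟩ := exists_linear_section hJ
  set J' := J.erase j with hJ'
  have hjJ' : j ∉ J' := by simp [hJ']
  set u := r (v j) with hu
  have huj : ∀ x, r x j = 0 := fun x => hr x j hjJ'
  set w : EuclideanSpace ℝ ι := EuclideanSpace.single j 1 - u with hw
  have hwj : w j = 1 := by simp [hw, hu, huj]
  let L : (relations v J' × ℝ) →ₗ[ℝ] EuclideanSpace ℝ ι :=
    (relations v J').subtype.coprod (LinearMap.toSpanSingleton ℝ _ w)
  have hLap : ∀ k t, L (k, t) = k + t • w := fun k t => by simp [L]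
  have hkj : ∀ k : relations v J', (k : EuclideanSpace ℝ ι) j = 0 :=
    fun k => (mem_relations.1 k.2).1 j hjJ'
  have hker : L.ker = ⊥ := by
    rw [LinearMap.ker_eq_bot']
    rintro ⟨k, t⟩ h
    rw [hLap] at h
    have ht : t = 0 := by
      have := congrArg (fun y : EuclideanSpace ℝ ι => y j) h
      simpa [hkj, hwj] using this
    subst ht
    simpa using h
  have hcw : comb v w = 0 := by simp [hw, comb_single, hu, hrv]
  have hwJ : ∀ i ∉ J, w i = 0 := by
    intro i hi
    have h1 : i ≠ j := fun h => hi (h ▸ hj)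
    have h2 : i ∉ J' := fun h => hi (Finset.mem_of_mem_erase h)
    simp [hw, h1, hu, hr _ i h2]
  have hrange : L.range = relations v J := by
    ext y
    constructor
    · rintro ⟨⟨k, t⟩, rfl⟩
      obtain ⟨h1, h2⟩ := mem_relations.1 k.2
      rw [hLap]
      refine mem_relations.2 ⟨fun i hi => ?_, by simp [h2, hcw]⟩
      simp [h1 i (fun h => hi (Finset.mem_of_mem_erase h)), hwJ i hi]
    · intro hy
      obtain ⟨h1, h2⟩ := mem_relations.1 hy
      refine ⟨(⟨y - y j • w, mem_relations.2 ⟨fun i hi => ?_, by simp [h2, hcw]⟩⟩, y j), ?_⟩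
      · by_cases hij : i = j
        · subst hij; simp [hwj]
        · have : i ∉ J := fun h => hi (Finset.mem_erase.2 ⟨hij, h⟩)
          simp [h1 i this, hwJ i this]
      · rw [hLap]; simp
  have hfin : finrank ℝ (relations v J) = finrank ℝ (relations v J') + 1 := by
    rw [← hrange, LinearMap.finrank_range_of_inj (LinearMap.ker_eq_bot.1 hker)]
    simp
  have hemb := (LinearMap.isClosedEmbedding_of_injective hker).measurableEmbedding
  let μ₁ : Measure (relations v J' × ℝ) := (μH[(finrank ℝ (relations v J) : ℝ)]).comap L
  have hμ₁ : μ₁.IsAddHaarMeasure :=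
    isAddHaarMeasure_comap_hausdorffMeasure L hker (by rw [hfin]; simp)
  let μ₂ : Measure (relations v J' × ℝ) := (relMeasure v J').prod volume
  obtain ⟨c, hc, hsmul⟩ : ∃ c : ℝ≥0, 0 < c ∧ μ₁ = c • μ₂ :=
    ⟨_, Measure.addHaarScalarFactor_pos_of_isAddHaarMeasure μ₁ μ₂,
      Measure.isAddLeftInvariant_eq_smul μ₁ μ₂⟩
  -- nonnegativity away from `j`, after translating by `r x`
  let S : E → Set (relations v J' × ℝ) := fun x =>
    {q | ∀ i, 0 ≤ (q.1 : EuclideanSpace ℝ ι) i + r (x - q.2 • v j) i}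
  have hS : ∀ x, MeasurableSet (S x) := by
    intro x
    refine IsClosed.measurableSet ?_
    simp only [S, Set.ofPred_forall, map_sub, map_smul]
    refine isClosed_iInter fun i => isClosed_le continuous_const ?_
    simp only [PiLp.sub_apply, PiLp.smul_apply]
    fun_prop
  have hslice : ∀ x t, relMeasure v J' ((fun k => (k, t)) ⁻¹' S x) =
      fiberVol v J' (x - t • v j) := by
    intro x t
    conv_rhs => rw [← hrv (x - t • v j)]
    exact relMeasure_translate (hr (x - t • v j))
  refine ⟨hfin, fun x => ?_, c, hc, fun x => ?_⟩
  · simp_rw [← hslice]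
    exact measurable_measure_prodMk_right (hS x)
  · have himage : r x +ᵥ L '' (S x ∩ Prod.snd ⁻¹' Set.Ici 0) = fiber v J x := by
      have key : ∀ (k : relations v J') t, r x + L (k, t) = (k + r (x - t • v j)) +
          EuclideanSpace.single j t := by
        intro k t
        rw [hLap, map_sub, map_smul, hw, smul_sub]
        have : EuclideanSpace.single j t = t • EuclideanSpace.single j (1 : ℝ) := by
          ext i; by_cases h : i = j <;> simp [h]
        rw [this]
        abel
      ext y
      simp only [Set.mem_vadd_set, Set.mem_image, vadd_eq_add]
      constructor
      · rintro ⟨_, ⟨⟨k, t⟩, ⟨h1, h2⟩, rfl⟩, rfl⟩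
        have ht : 0 ≤ t := h2
        obtain ⟨hk1, hk2⟩ := mem_relations.1 k.2
        refine ⟨fun i => ?_, fun i hi => ?_, ?_⟩
        · rw [key]
          have := h1 i
          by_cases hij : i = j
          · subst hij; simpa [hkj, huj] using ht
          · simpa [hij] using this
        · rw [hLap]
          have : i ∉ J' := fun h => hi (Finset.mem_of_mem_erase h)
          simp [hk1 i this, hwJ i hi, hr x i this]
        · rw [hLap]; simp [hk2, hcw, hrv]
      · rintro ⟨h1, h2, h3⟩
        have hmem : y - r x ∈ L.range := by
          rw [hrange]
          refine mem_relations.2 ⟨fun i hi => ?_, by simp [h3, hrv]⟩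
          simp [h2 i hi, hr x i (fun h => hi (Finset.mem_of_mem_erase h))]
        obtain ⟨⟨k, t⟩, hkt⟩ := hmem
        have hy : y = (k + r (x - t • v j)) + EuclideanSpace.single j t := by
          rw [← key, hkt]; abel
        refine ⟨y - r x, ⟨(k, t), ⟨fun i => ?_, ?_⟩, hkt⟩, by abel⟩
        · by_cases hij : i = j
          · subst hij; simp [hkj, huj]
          · have := h1 i
            rw [hy] at this
            simpa [hij] using this
        · have := h1 j
          rw [hy] at this
          simpa [hkj, huj] using this
    have h1 : fiberVol v J x = μ₁ (S x ∩ Prod.snd ⁻¹' Set.Ici 0) := by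
      rw [fiberVol, ← himage, hausdorffMeasure_vadd (r x) (Or.inl (Nat.cast_nonneg _)),
        hemb.comap_apply]
    rw [h1, hsmul, Measure.smul_apply,
      Measure.prod_apply_symm ((hS x).inter (measurable_snd measurableSet_Ici)),
      ← lintegral_indicator measurableSet_Ici, ENNReal.smul_def, smul_eq_mul]
    congr 1
    refine lintegral_congr fun t => ?_
    by_cases ht : t ∈ Set.Ici (0 : ℝ)
    · rw [Set.indicator_of_mem ht, ← hslice]
      congr 1
      ext k
      simpa using fun _ => ht
    · rw [Set.indicator_of_notMem ht]
      convert measure_empty (μ := relMeasure v J')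
      ext k
      simpa using fun _ => lt_of_not_ge ht

end Fibers

section Topology

open scoped Topology Pointwise NNReal
open Module Filter

variable {ι E : Type*} [Fintype ι] [NormedAddCommGroup E] [NormedSpace ℝ E]

lemma exists_pos_functional_s17 (v : ι → E) (h0 : (0 : E) ∉ convexHull ℝ (Set.range v)) :
    ∃ ℓ : E →L[ℝ] ℝ, ∀ j, 0 < ℓ (v j) := by
  obtain ⟨ℓ, u, h1, h2⟩ := geometric_hahn_banach_point_closed (convex_convexHull ℝ (Set.range v))
    ((Set.finite_range v).isClosed_convexHull ℝ) h0
  refine ⟨ℓ, fun j => ?_⟩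
  have := h2 (v j) (subset_convexHull ℝ _ ⟨j, rfl⟩)
  rw [map_zero] at h1
  linarith

lemma continuous_comb (v : ι → E) : Continuous (comb v) := by
  have : ⇑(comb v) = fun y => ∑ j, y j • v j := funext (comb_apply v)
  rw [this]
  fun_prop

lemma isCompact_nonneg_le {v : ι → E} {ℓ : E →L[ℝ] ℝ} (hℓ : ∀ j, 0 < ℓ (v j))
    (J : Finset ι) (R : ℝ) :
    IsCompact {y : EuclideanSpace ℝ ι |
      (∀ j, 0 ≤ y j) ∧ (∀ j ∉ J, y j = 0) ∧ ℓ (comb v y) ≤ R} := by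
  have hK : IsCompact (WithLp.toLp 2 '' Set.univ.pi fun j => Set.Icc (0 : ℝ) (R / ℓ (v j))) :=
    (isCompact_univ_pi fun j => isCompact_Icc).image (PiLp.continuous_toLp 2 _)
  refine hK.of_isClosed_subset ?_ ?_
  · simp only [Set.ofPred_and, Set.ofPred_forall]
    refine (isClosed_iInter fun j => isClosed_le (by fun_prop) (by fun_prop)).inter
      ((isClosed_iInter fun j => isClosed_iInter fun _ =>
        isClosed_eq (by fun_prop) (by fun_prop)).inter
        (isClosed_le (ℓ.continuous.comp (continuous_comb v)) continuous_const))
  · rintro y ⟨h1, -, h2⟩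
    refine ⟨y.ofLp, fun j _ => ⟨h1 j, ?_⟩, by simp⟩
    rw [le_div_iff₀ (hℓ j)]
    refine le_trans ?_ h2
    rw [comb_apply, map_sum]
    simp only [map_smul, smul_eq_mul]
    exact Finset.single_le_sum (f := fun i => y i * ℓ (v i))
      (fun i _ => mul_nonneg (h1 i) (hℓ i).le) (Finset.mem_univ j)

lemma eventually_fiber_eq_empty {v : ι → E} {ℓ : E →L[ℝ] ℝ} (hℓ : ∀ j, 0 < ℓ (v j))
    {J : Finset ι} {x₀ : E} (hx₀ : fiber v J x₀ = ∅) : ∀ᶠ x in 𝓝 x₀, fiber v J x = ∅ := by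
  have hC := ((isCompact_nonneg_le hℓ J (ℓ x₀ + 1)).image (continuous_comb v)).isClosed
  have h1 : ∀ᶠ x in 𝓝 x₀, ℓ x < ℓ x₀ + 1 :=
    ℓ.continuous.continuousAt.eventually_lt continuousAt_const (by simp)
  have h2 := hC.isOpen_compl.mem_nhds (x := x₀) (by
    rintro ⟨y, ⟨ha, hb, -⟩, hy⟩
    exact Set.notMem_empty y (hx₀ ▸ ⟨ha, hb, hy⟩))
  filter_upwards [h1, h2] with x hx hx'
  refine Set.eq_empty_of_forall_notMem fun y hy => hx' ⟨y, ⟨hy.1, hy.2.1, ?_⟩, hy.2.2⟩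
  rw [hy.2.2]
  exact hx.le

lemma fiberVol_ne_top {v : ι → E} {ℓ : E →L[ℝ] ℝ} (hℓ : ∀ j, 0 < ℓ (v j))
    {J : Finset ι} (x : E) : fiberVol v J x ≠ ⊤ := by
  rcases (fiber v J x).eq_empty_or_nonempty with h | ⟨z, -, hz, rfl⟩
  · simp [fiberVol, h]
  rw [← relMeasure_translate hz]
  have hemb := LinearMap.isClosedEmbedding_of_injective (Submodule.ker_subtype (relations v J))
  have hK := hemb.isCompact_preimage
    ((isCompact_nonneg_le hℓ J (ℓ (comb v z))).image (continuous_add_const (-z)))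
  refine ne_top_of_le_ne_top hK.measure_lt_top.ne (measure_mono fun k hk => ?_)
  obtain ⟨h1, h2⟩ := mem_relations.1 k.2
  refine ⟨k + z, ⟨hk, fun j hj => by simp [h1 j hj, hz j hj], by simp [h2]⟩, by simp⟩

lemma fiberVol_smul (v : ι → E) (J : Finset ι) {t : ℝ} (ht : 0 < t) (x : E) :
    (fiberVol v J (t • x)).toReal =
      t ^ finrank ℝ (relations v J) * (fiberVol v J x).toReal := by
  have : fiber v J (t • x) = t • fiber v J x := by
    ext y
    rw [Set.mem_smul_set_iff_inv_smul_mem₀ ht.ne']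
    simp only [fiber, Set.mem_ofPred_eq, PiLp.smul_apply, map_smul, smul_eq_mul]
    refine and_congr (forall_congr' fun j => ?_)
      (and_congr (forall₂_congr fun j _ => ?_) ?_)
    · rw [mul_nonneg_iff_of_pos_left (inv_pos.2 ht)]
    · simp [ht.ne']
    · rw [inv_smul_eq_iff₀ ht.ne']
  rw [fiberVol, this, Measure.hausdorffMeasure_smul₀ (Nat.cast_nonneg _) ht.ne', ← fiberVol,
    ENNReal.smul_def, smul_eq_mul, ENNReal.toReal_mul]
  simp [abs_of_pos ht]

/-- Directional derivative of a fiber volume along a vector whose complement still spans. -/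
lemma exists_hasDerivAt_fiberVol [DecidableEq ι] {v : ι → E} {ℓ : E →L[ℝ] ℝ}
    (hℓ : ∀ j, 0 < ℓ (v j)) {J : Finset ι} {j : ι} (hj : j ∈ J)
    (hJ : Submodule.span ℝ (v '' (J.erase j : Finset ι)) = ⊤) :
    ∃ c : ℝ, ∀ x, ContinuousAt (fun y => (fiberVol v (J.erase j) y).toReal) x →
      HasDerivAt (fun t : ℝ => (fiberVol v J (x + t • v j)).toReal)
        (c * (fiberVol v (J.erase j) x).toReal) 0 := by
  obtain ⟨-, hmeas, c, hc, hvol⟩ := exists_fiberVol_eq_lintegral hj hJ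
  refine ⟨c, fun x hx => ?_⟩
  set φ : ℝ → ℝ≥0∞ := fun r => fiberVol v (J.erase j) (x + r • v j) with hφ
  have hφm : Measurable φ := by
    have := (hmeas x).comp measurable_neg
    simpa [Function.comp_def, hφ] using this
  have hval : ∀ τ, fiberVol v J (x + τ • v j) = c * ∫⁻ r in Set.Iic τ, φ r := by
    intro τ
    rw [hvol, ← lintegral_indicator measurableSet_Ici, ← lintegral_indicator measurableSet_Iic,
      ← lintegral_sub_left_eq_self _ τ]
    congr 1
    refine lintegral_congr fun t => ?_
    by_cases ht : t ≤ τ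
    · rw [Set.indicator_of_mem (by simpa using ht), Set.indicator_of_mem (by simpa using ht)]
      simp only [hφ, sub_smul]
      congr 1
      abel
    · rw [Set.indicator_of_notMem (by simpa using ht), Set.indicator_of_notMem (by simpa using ht)]
  have hfin : ∀ τ, ∫⁻ r in Set.Iic τ, φ r ≠ ⊤ := by
    intro τ h
    have := fiberVol_ne_top hℓ (J := J) (x + τ • v j)
    rw [hval, h, ENNReal.mul_top (by exact_mod_cast hc.ne')] at this
    exact this rfl
  have hio : ∀ τ, IntegrableOn (fun r => (φ r).toReal) (Set.Iic τ) := fun τ =>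
    integrable_toReal_of_lintegral_ne_top hφm.aemeasurable (hfin τ)
  have hreal : ∀ τ, (fiberVol v J (x + τ • v j)).toReal =
      c * ((∫ r in Set.Iic (0 : ℝ), (φ r).toReal) + ∫ r in (0 : ℝ)..τ, (φ r).toReal) := by
    intro τ
    rw [← intervalIntegral.integral_Iic_sub_Iic (hio 0) (hio τ), add_sub_cancel, hval,
      ENNReal.toReal_mul, ENNReal.coe_toReal, integral_toReal hφm.aemeasurable
        (Eventually.of_forall fun r => (fiberVol_ne_top hℓ _).lt_top)]
  have hcont : ContinuousAt (fun r => (φ r).toReal) 0 := by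
    have : ContinuousAt (fun r : ℝ => x + r • v j) 0 := by fun_prop
    exact ContinuousAt.comp (f := fun r : ℝ => x + r • v j) (by simpa using hx) this
  have hd := intervalIntegral.integral_hasDerivAt_right (f := fun r => (φ r).toReal)
    (IntervalIntegrable.refl (a := 0))
    hφm.ennreal_toReal.stronglyMeasurable.stronglyMeasurableAtFilter hcont
  simp_rw [hreal]
  simpa [hφ] using (hd.const_add (∫ r in Set.Iic (0 : ℝ), (φ r).toReal)).const_mul (c : ℝ)

/-- Near a point of the cone off the cone of `J.erase j`, the fiber volume is constant along `v j`
if deleting `v j` destroys the spanning property. -/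
lemma eventually_hasDerivAt_fiberVol_zero [FiniteDimensional ℝ E] [DecidableEq ι] {v : ι → E}
    {J : Finset ι} {j : ι}
    (hj : j ∈ J) (hJ : Submodule.span ℝ (v '' J) = ⊤)
    (hJ' : Submodule.span ℝ (v '' (J.erase j : Finset ι)) ≠ ⊤) {x₀ : E}
    (hx₀ : (fiber v J x₀).Nonempty) (hx₀' : fiber v (J.erase j) x₀ = ∅) :
    ∀ᶠ x in 𝓝 x₀, HasDerivAt (fun t : ℝ => (fiberVol v J (x + t • v j)).toReal) 0 0 := by
  obtain ⟨g, hg0, hg⟩ := Submodule.exists_le_ker_of_lt_top _ (lt_top_iff_ne_top.2 hJ')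
  have hgi : ∀ i ∈ J, i ≠ j → g (v i) = 0 := fun i hi hij =>
    hg (Submodule.subset_span ⟨i, by simp [hi, hij], rfl⟩)
  have hgj : g (v j) ≠ 0 := by
    intro h
    apply hg0
    rw [← LinearMap.ker_eq_top, eq_top_iff, ← hJ, Submodule.span_le]
    rintro _ ⟨i, hi, rfl⟩
    by_cases hij : i = j
    · subst hij; exact h
    · exact hgi i hi hij
  have hcoord : ∀ y : EuclideanSpace ℝ ι, (∀ i ∉ J, y i = 0) →
      y j = (g (v j))⁻¹ * g (comb v y) := by
    intro y hy
    rw [comb_apply, map_sum, Finset.sum_eq_single j]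
    · simp [hgj, mul_comm]
    · intro i _ hij
      by_cases hi : i ∈ J
      · simp [hgi i hi hij]
      · simp [hy i hi]
    · simp
  set G : E → ℝ := fun x => (g (v j))⁻¹ * g x with hG
  have hGc : Continuous G := continuous_const.mul g.continuous_of_finiteDimensional
  have hGadd : ∀ x (t : ℝ), G (x + t • v j) = G x + t := by
    intro x t
    simp only [hG, map_add, map_smul, smul_eq_mul]
    field_simp
  have hpos : 0 < G x₀ := by
    obtain ⟨z, hz1, hz2, hz3⟩ := hx₀
    have h1 : z j = G x₀ := by rw [hcoord z hz2, hz3]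
    refine lt_of_le_of_ne (h1 ▸ hz1 j) fun h => ?_
    have : z ∈ fiber v (J.erase j) x₀ := by
      refine ⟨hz1, fun i hi => ?_, hz3⟩
      by_cases hij : i = j
      · rw [hij, h1, ← h]
      · exact hz2 i fun hi' => hi (Finset.mem_erase.2 ⟨hij, hi'⟩)
    simp [hx₀'] at this
  have hmono : ∀ x (t : ℝ), 0 < G x → 0 < G x + t → ∀ y ∈ fiber v J x,
      EuclideanSpace.single j t + y ∈ fiber v J (x + t • v j) := by
    rintro x t - ht y ⟨h1, h2, h3⟩
    refine ⟨fun i => ?_, fun i hi => ?_, ?_⟩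
    · by_cases hij : i = j
      · subst hij
        have := hcoord y h2
        rw [h3] at this
        change y i = G x at this
        simp only [PiLp.add_apply, PiLp.single_apply, if_true, this]
        linarith
      · simpa [hij] using h1 i
    · have hij : i ≠ j := fun h => hi (h ▸ hj)
      simp [hij, h2 i hi]
    · rw [map_add, comb_single, h3, add_comm]
  have hconst : ∀ x (t : ℝ), 0 < G x → 0 < G x + t →
      fiberVol v J (x + t • v j) = fiberVol v J x := by
    intro x t hx ht
    rw [fiberVol, fiberVol, ← hausdorffMeasure_vadd (EuclideanSpace.single j t)
      (Or.inl (Nat.cast_nonneg _)) (fiber v J x)]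
    congr 1
    ext y
    simp only [Set.mem_vadd_set, vadd_eq_add]
    constructor
    · intro hy
      refine ⟨EuclideanSpace.single j (-t) + y, ?_, ?_⟩
      · have := hmono (x + t • v j) (-t) (by rwa [hGadd]) (by rw [hGadd]; simpa) y hy
        simpa using this
      · ext i; by_cases hij : i = j <;> simp [hij]
    · rintro ⟨z, hz, rfl⟩
      exact hmono x t hx ht z hz
  filter_upwards [hGc.continuousAt.eventually_const_lt hpos] with x hx
  have : ∀ᶠ t : ℝ in 𝓝 0, 0 < G x + t :=
    (continuous_const.add continuous_id).continuousAt.eventually_const_lt (by simpa using hx)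
  refine (hasDerivAt_const (0 : ℝ) (fiberVol v J x).toReal).congr_of_eventuallyEq ?_
  filter_upwards [this] with t ht
  rw [hconst x t hx ht]

end Topology

section Calculus

open scoped Topology
open Filter Asymptotics

variable {ι E : Type*} [NormedAddCommGroup E] [NormedSpace ℝ E]

/-- A function with directional derivative along `u` continuous at `x` is strictly differentiable
along `u` at `x`, uniformly in the base point. -/
lemma isLittleO_of_hasDerivAt_along {f g : E → ℝ} {x u : E}
    (hd : ∀ᶠ y in 𝓝 x, HasDerivAt (fun t : ℝ => f (y + t • u)) (g y) 0) (hg : ContinuousAt g x)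
    {α : Type*} {l : Filter α} {w : α → E} {a : α → ℝ} (hw : Tendsto w l (𝓝 0))
    (ha : Tendsto a l (𝓝 0)) :
    (fun z => f (x + w z + a z • u) - f (x + w z) - a z * g x) =o[l] a := by
  rw [isLittleO_iff]
  intro ε hε
  have hgε : ∀ᶠ y in 𝓝 x, ‖g y - g x‖ ≤ ε := by
    filter_upwards [hg (Metric.closedBall_mem_nhds (g x) hε)] with y hy
    simpa [dist_eq_norm] using hy
  obtain ⟨δ, hδ, hball⟩ := Metric.eventually_nhds_iff_ball.1 (hd.and hgε)
  have h1 : Tendsto (fun z => x + w z) l (𝓝 x) := by simpa using tendsto_const_nhds.add hw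
  have h2 : Tendsto (fun z => x + w z + a z • u) l (𝓝 x) := by
    simpa using h1.add (ha.smul_const u)
  filter_upwards [h1 (Metric.ball_mem_nhds x hδ), h2 (Metric.ball_mem_nhds x hδ)] with z hz1 hz2
  set s : Set ℝ := {t | x + w z + t • u ∈ Metric.ball x δ} with hs
  have hconv : Convex ℝ s := ((convex_ball x δ).translate_preimage_right (x + w z)).linear_preimage
    (LinearMap.toSpanSingleton ℝ E u)
  have hder : ∀ t ∈ s, HasDerivWithinAt (fun t : ℝ => f (x + w z + t • u) - t * g x)
      (g (x + w z + t • u) - g x) s t := by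
    intro t ht
    have h3 : HasDerivAt (fun τ : ℝ => f (x + w z + t • u + (τ - t) • u))
        (g (x + w z + t • u)) t :=
      HasDerivAt.comp_sub_const t t (by simpa using (hball _ ht).1)
    have h4 : (fun τ : ℝ => f (x + w z + t • u + (τ - t) • u)) =
        fun τ : ℝ => f (x + w z + τ • u) := by
      funext τ
      congr 1
      rw [sub_smul]
      abel
    rw [h4] at h3
    simpa using (h3.fun_sub ((hasDerivAt_id t).mul_const (g x))).hasDerivWithinAt
  have := hconv.norm_image_sub_le_of_norm_hasDerivWithin_le hder
    (fun t ht => (hball _ ht).2) (x := 0) (y := a z) (by simpa [hs] using hz1) hz2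
  simpa [sub_right_comm] using this

/-- Continuous directional derivatives along vectors which reconstruct every `h` through the
coefficient functionals `a j` give a Fréchet derivative. -/
lemma hasFDerivAt_of_hasDerivAt_along {v : ι → E} {J : Finset ι} {f : E → ℝ} {g : ι → E → ℝ} {x : E}
    (a : ι → E →L[ℝ] ℝ) (ha : ∀ h, ∑ j ∈ J, a j h • v j = h)
    (hd : ∀ j ∈ J, ∀ᶠ y in 𝓝 x, HasDerivAt (fun t : ℝ => f (y + t • v j)) (g j y) 0)
    (hg : ∀ j ∈ J, ContinuousAt (g j) x) :
    HasFDerivAt f (∑ j ∈ J, g j x • a j) x := by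
  classical
  have key : ∀ S ⊆ J, (fun h => f (x + ∑ j ∈ S, a j h • v j) - f x - ∑ j ∈ S, a j h * g j x)
      =o[𝓝 0] fun h : E => h := by
    intro S
    induction S using Finset.induction_on with
    | empty => intro _; simp
    | insert i S hi ih =>
      intro hS
      have hiJ := hS (Finset.mem_insert_self i S)
      have hw : Tendsto (fun h => ∑ j ∈ S, a j h • v j) (𝓝 0) (𝓝 0) := by
        have : Continuous fun h => ∑ j ∈ S, a j h • v j := by fun_prop
        simpa using this.tendsto 0
      have ha0 : Tendsto (a i) (𝓝 0) (𝓝 0) := by simpa using (a i).continuous.tendsto 0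
      have h1 := (isLittleO_of_hasDerivAt_along (hd i hiJ) (hg i hiJ) hw ha0).trans_isBigO
        ((a i).isBigO_id (𝓝 0))
      refine ((ih ((Finset.subset_insert i S).trans hS)).add h1).congr_left fun h => ?_
      rw [Finset.sum_insert hi, Finset.sum_insert hi, add_comm (a i h • v i), ← add_assoc]
      ring
  rw [hasFDerivAt_iff_isLittleO_nhds_zero]
  refine (key J subset_rfl).congr_left fun h => ?_
  rw [ha]
  simp [mul_comm]

end Calculus

section Polynomial

open scoped Topology
open Filter MvPolynomial

variable {σ : Type*}

/-- The directional derivative of polynomials along `u`. -/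
noncomputable def dirDeriv (u : σ → ℝ) : Derivation ℝ (MvPolynomial σ ℝ) (MvPolynomial σ ℝ) :=
  mkDerivation ℝ fun i => C (u i)

lemma foldr_dirDeriv_zero (l : List (σ → ℝ)) :
    l.foldr (fun u (q : MvPolynomial σ ℝ) => dirDeriv u q) 0 = 0 := by
  induction l with
  | nil => rfl
  | cons u l ih => rw [List.foldr_cons, ih, map_zero]

lemma foldr_dirDeriv_smul (c : ℝ) (q : MvPolynomial σ ℝ) (l : List (σ → ℝ)) :
    l.foldr (fun u q => dirDeriv u q) (c • q) =
      c • l.foldr (fun u q => dirDeriv u q) q := by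
  induction l with
  | nil => rfl
  | cons u l ih => rw [List.foldr_cons, List.foldr_cons, ih, Derivation.map_smul]

variable [Fintype σ]

lemma exists_hasFDerivAt_eval (p : MvPolynomial σ ℝ) (x : σ → ℝ) :
    ∃ f' : (σ → ℝ) →L[ℝ] ℝ, HasFDerivAt (fun y => eval y p) f' x ∧
      ∀ u, f' u = eval x (dirDeriv u p) := by
  induction p using MvPolynomial.induction_on with
  | C c => exact ⟨0, by simpa using hasFDerivAt_const c x, by simp [dirDeriv]⟩
  | add p q hp hq =>
    obtain ⟨p', hp, hp'⟩ := hp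
    obtain ⟨q', hq, hq'⟩ := hq
    exact ⟨p' + q', by simpa using hp.fun_add hq, by simp [hp', hq']⟩
  | mul_X p i hp =>
    obtain ⟨p', hp, hp'⟩ := hp
    refine ⟨_, by simpa using hp.fun_mul (hasFDerivAt_apply i x), fun u => ?_⟩
    simp [dirDeriv, hp', mul_comm]

lemma fderiv_eval (p : MvPolynomial σ ℝ) (x u : σ → ℝ) :
    fderiv ℝ (fun y => eval y p) x u = eval x (dirDeriv u p) := by
  obtain ⟨f', h, h'⟩ := exists_hasFDerivAt_eval p x
  rw [h.fderiv, h']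

lemma hasDerivAt_eval_along (p : MvPolynomial σ ℝ) (x u : σ → ℝ) :
    HasDerivAt (fun t : ℝ => eval (x + t • u) p) (eval x (dirDeriv u p)) 0 := by
  obtain ⟨f', h, h'⟩ := exists_hasFDerivAt_eval p x
  rw [← h']
  have hline : HasDerivAt (fun t : ℝ => x + t • u) u 0 := by
    simpa using ((hasDerivAt_id (0 : ℝ)).smul_const u).const_add x
  exact HasFDerivAt.comp_hasDerivAt (f := fun t : ℝ => x + t • u) 0 (by simpa using h) hline

lemma eq_of_eventually_eval_eq {p q : MvPolynomial σ ℝ} {x₀ : σ → ℝ}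
    (h : ∀ᶠ x in 𝓝 x₀, eval x p = eval x q) : p = q := by
  obtain ⟨ε, hε, hball⟩ := Metric.eventually_nhds_iff_ball.1 h
  refine funext_set (fun i => Metric.ball (x₀ i) ε) (fun i => ?_) fun x hx => ?_
  · rw [Real.ball_eq_Ioo]
    exact Set.Ioo_infinite (by linarith)
  · exact hball x (by rwa [ball_pi x₀ hε])

/-- The linear form with coefficients read off on the standard basis, as a polynomial. -/
lemma exists_linear_polynomial (a : (σ → ℝ) →ₗ[ℝ] ℝ) :
    ∃ p : MvPolynomial σ ℝ, p.IsHomogeneous 1 ∧ ∀ x, eval x p = a x := by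
  classical
  refine ⟨∑ i, C (a (Pi.single i 1)) * X i, ?_, fun x => ?_⟩
  · exact IsHomogeneous.sum _ _ _ fun i _ => (isHomogeneous_X ℝ i).C_mul _
  · conv_rhs => rw [← LinearMap.sum_single_apply (fun _ : σ => ℝ) x, map_sum]
    simp only [map_sum, map_mul, eval_C, eval_X]
    refine Finset.sum_congr rfl fun i _ => ?_
    have : (Pi.single i (x i) : σ → ℝ) = x i • Pi.single i 1 := by
      rw [← Pi.single_smul]; simp
    simp [this, mul_comm]

end Polynomial

section LocalPolynomial

open scoped Topology
open Module Filter MvPolynomial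

variable {ι σ : Type*} [Fintype ι] [Fintype σ]

/-- If `f` is homogeneous of degree `d` near `x₀` along rays and its derivatives along a spanning
family are homogeneous polynomials of degree `d - 1`, then `f` is a homogeneous polynomial of
degree `d` near `x₀`. -/
lemma exists_homogeneous_of_hasDerivAt_along {v : ι → σ → ℝ} {J : Finset ι}
    (hJ : Submodule.span ℝ (v '' J) = ⊤) {f : (σ → ℝ) → ℝ} {d : ℕ}
    (hf : ∀ t : ℝ, 0 < t → ∀ x, f (t • x) = t ^ d * f x) {x₀ : σ → ℝ}
    {g : ι → MvPolynomial σ ℝ} (hg : ∀ j ∈ J, (g j).IsHomogeneous (d - 1))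
    (hg0 : d = 0 → ∀ j ∈ J, g j = 0)
    (hd : ∀ j ∈ J, ∀ᶠ x in 𝓝 x₀, HasDerivAt (fun t : ℝ => f (x + t • v j)) (eval x (g j)) 0) :
    ∃ p : MvPolynomial σ ℝ, p.IsHomogeneous d ∧ ∀ᶠ x in 𝓝 x₀, f x = eval x p := by
  obtain ⟨r, hr, hrv⟩ := exists_linear_section hJ
  let a : ι → (σ → ℝ) →ₗ[ℝ] ℝ := fun j =>
    (EuclideanSpace.projₗ j : EuclideanSpace ℝ ι →ₗ[ℝ] ℝ) ∘ₗ r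
  have ha : ∀ h, ∑ j ∈ J, a j h • v j = h := by
    intro h
    conv_rhs => rw [← hrv h, comb_apply]
    exact Finset.sum_subset (Finset.subset_univ J) fun j _ hj => by simp [a, hr h j hj]
  have hF : ∀ᶠ x in 𝓝 x₀, HasFDerivAt f
      (∑ j ∈ J, eval x (g j) • LinearMap.toContinuousLinearMap (a j)) x := by
    have : ∀ᶠ x in 𝓝 x₀, ∀ j ∈ J, ∀ᶠ y in 𝓝 x,
        HasDerivAt (fun t : ℝ => f (y + t • v j)) (eval y (g j)) 0 :=
      (Finset.eventually_all J).2 fun j hj => (hd j hj).eventually_nhds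
    filter_upwards [this] with x hx
    exact hasFDerivAt_of_hasDerivAt_along (g := fun j y => eval y (g j)) _ ha hx
      fun j _ => (MvPolynomial.continuous_eval (g j)).continuousAt
  rcases Nat.eq_zero_or_pos d with rfl | hdpos
  · obtain ⟨δ, hδ, hball⟩ := Metric.eventually_nhds_iff_ball.1 hF
    have hball0 : ∀ x ∈ Metric.ball x₀ δ, HasFDerivAt f (0 : (σ → ℝ) →L[ℝ] ℝ) x := by
      intro x hx
      convert hball x hx
      exact (Finset.sum_eq_zero fun j hj => by simp [hg0 rfl j hj]).symm
    refine ⟨C (f x₀), isHomogeneous_C _ _, ?_⟩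
    filter_upwards [Metric.ball_mem_nhds x₀ hδ] with x hx
    rw [eval_C]
    exact Metric.isOpen_ball.is_const_of_fderiv_eq_zero (convex_ball x₀ δ).isPreconnected
      (fun y hy => (hball0 y hy).differentiableAt.differentiableWithinAt)
      (fun y hy => (hball0 y hy).fderiv) hx (Metric.mem_ball_self hδ)
  · choose A hA hA' using fun j => exists_linear_polynomial (a j)
    refine ⟨C ((d : ℝ)⁻¹) * ∑ j ∈ J, A j * g j, ?_, ?_⟩
    · refine (IsHomogeneous.sum _ _ _ fun j hj => ?_).C_mul _
      have := (hA j).mul (hg j hj)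
      rwa [Nat.add_sub_cancel' hdpos] at this
    · filter_upwards [hF] with x hx
      have hray : HasDerivAt (fun t : ℝ => t • x) x 1 := by
        simpa using (hasDerivAt_id (1 : ℝ)).smul_const x
      have h1 := HasFDerivAt.comp_hasDerivAt (f := fun t : ℝ => t • x) 1
        (by simpa using hx) hray
      have h2 : HasDerivAt (f ∘ fun t : ℝ => t • x) (d * f x) 1 := by
        have : HasDerivAt (fun t : ℝ => t ^ d * f x) (d * f x) 1 := by
          simpa using (hasDerivAt_pow d (1 : ℝ)).mul_const (f x)
        refine this.congr_of_eventuallyEq ?_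
        filter_upwards [lt_mem_nhds (zero_lt_one' ℝ)] with t ht
        exact hf t ht x
      have h3 := h2.unique h1
      have hd0 : (d : ℝ) ≠ 0 := by positivity
      rw [map_mul, eval_C, map_sum, eq_inv_mul_iff_mul_eq₀ hd0, h3]
      simp [hA', mul_comm]

/-- Away from the cones of non-spanning subfamilies, fiber volumes are locally given by homogeneous
polynomials which are annihilated by the corresponding products of directional derivatives. -/
lemma exists_local_polynomial [DecidableEq ι] {v : ι → σ → ℝ} {ℓ : (σ → ℝ) →L[ℝ] ℝ}
    (hℓ : ∀ j, 0 < ℓ (v j)) {x₀ : σ → ℝ}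
    (hx₀ : ∀ J : Finset ι, Submodule.span ℝ (v '' J) ≠ ⊤ → fiber v J x₀ = ∅)
    (J : Finset ι) (hJ : Submodule.span ℝ (v '' J) = ⊤) :
    ∃ p : MvPolynomial σ ℝ, p.IsHomogeneous (finrank ℝ (relations v J)) ∧
      (∀ l : List ι, l.Nodup → (∀ i ∈ l, i ∈ J) →
        Submodule.span ℝ (v '' (J \ l.toFinset : Finset ι)) ≠ ⊤ →
        (l.map v).foldr (fun u q => dirDeriv u q) p = 0) ∧
      ∀ᶠ x in 𝓝 x₀, (fiberVol v J x).toReal = eval x p := by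
  induction J using Finset.strongInduction with
  | H J ih =>
  rcases (fiber v J x₀).eq_empty_or_nonempty with hemp | hne
  · refine ⟨0, isHomogeneous_zero _ _ _, fun l _ _ _ => foldr_dirDeriv_zero _, ?_⟩
    filter_upwards [eventually_fiber_eq_empty hℓ hemp] with x hx
    simp [fiberVol, hx]
  have hg : ∀ j ∈ J, ∃ g : MvPolynomial σ ℝ,
      g.IsHomogeneous (finrank ℝ (relations v J) - 1) ∧
      (finrank ℝ (relations v J) = 0 → g = 0) ∧
      (∀ l : List ι, l.Nodup → (∀ i ∈ l, i ∈ J.erase j) →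
        Submodule.span ℝ (v '' (J.erase j \ l.toFinset : Finset ι)) ≠ ⊤ →
        (l.map v).foldr (fun u q => dirDeriv u q) g = 0) ∧
      ∀ᶠ x in 𝓝 x₀,
        HasDerivAt (fun t : ℝ => (fiberVol v J (x + t • v j)).toReal) (eval x g) 0 := by
    intro j hj
    by_cases hspan : Submodule.span ℝ (v '' (J.erase j : Finset ι)) = ⊤
    · obtain ⟨q, hq1, hq2, hq3⟩ := ih _ (Finset.erase_ssubset hj) hspan
      have hfin := (exists_fiberVol_eq_lintegral hj hspan).1
      obtain ⟨c, hc⟩ := exists_hasDerivAt_fiberVol hℓ hj hspan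
      refine ⟨c • q, ?_, by omega, fun l h1 h2 h3 => ?_, ?_⟩
      · rw [hfin, Nat.add_sub_cancel, smul_eq_C_mul]
        exact hq1.C_mul c
      · rw [foldr_dirDeriv_smul, hq2 l h1 h2 h3, smul_zero]
      · filter_upwards [hq3.eventually_nhds] with x hx
        have hcont : ContinuousAt (fun y => (fiberVol v (J.erase j) y).toReal) x :=
          (MvPolynomial.continuous_eval q).continuousAt.congr (hx.mono fun y hy => hy.symm)
        have := hc x hcont
        rwa [hx.self_of_nhds, ← smul_eval] at this
    · refine ⟨0, isHomogeneous_zero _ _ _, fun _ => rfl, fun l _ _ _ => foldr_dirDeriv_zero _, ?_⟩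
      simpa using eventually_hasDerivAt_fiberVol_zero hj hJ hspan hne (hx₀ _ hspan)
  choose! g hg1 hg2 hg3 hg4 using hg
  obtain ⟨p, hp, hpf⟩ := exists_homogeneous_of_hasDerivAt_along hJ
    (f := fun x => (fiberVol v J x).toReal)
    (fun t ht x => fiberVol_smul v J ht x) hg1 (fun h j hj => hg2 j hj h) hg4
  refine ⟨p, hp, fun l hnd hlJ hl => ?_, hpf⟩
  rcases List.eq_nil_or_concat l with rfl | ⟨l, j, rfl⟩
  · exact absurd (by simpa using hJ) hl
  rw [List.concat_eq_append] at hnd hlJ hl ⊢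
  have hj : j ∈ J := hlJ j (by simp)
  have hDp : dirDeriv (v j) p = g j := by
    refine eq_of_eventually_eval_eq (x₀ := x₀) ?_
    filter_upwards [hg4 j hj, hpf.eventually_nhds] with x h1 h2
    have hline : Tendsto (fun t : ℝ => x + t • v j) (𝓝 0) (𝓝 x) := by
      have : Continuous fun t : ℝ => x + t • v j := by fun_prop
      simpa using this.tendsto 0
    exact (hasDerivAt_eval_along p x (v j)).unique
      (h1.congr_of_eventuallyEq ((hline.eventually h2).mono fun t ht => ht.symm))
  have hnd' := List.nodup_append.1 hnd
  rw [List.map_append, List.foldr_append]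
  change (l.map v).foldr _ (dirDeriv (v j) p) = 0
  rw [hDp]
  refine hg3 j hj l hnd'.1 (fun i hi => Finset.mem_erase.2 ⟨?_, hlJ i (by simp [hi])⟩) ?_
  · exact hnd'.2.2 i hi j (by simp)
  · convert hl using 4
    ext i
    simp only [Finset.mem_sdiff, Finset.mem_erase, List.mem_toFinset, List.mem_append,
      List.mem_singleton]
    tauto

end LocalPolynomial

lemma DY_eval {s : ℕ} (l : List (Fin s → ℝ)) (p : MvPolynomial (Fin s) ℝ) :
    DY s l (fun x => MvPolynomial.eval x p) =
      fun x => MvPolynomial.eval x (l.foldr (fun u q => dirDeriv u q) p) := by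
  induction l with
  | nil => rfl
  | cons u l ih =>
    have : DY s (u :: l) (fun x => MvPolynomial.eval x p) =
        fun x => fderiv ℝ (DY s l fun x => MvPolynomial.eval x p) x u := rfl
    rw [this, ih]
    funext x
    exact fderiv_eval _ x u

lemma coneOf_eq_fiber_nonempty (s n : ℕ) (M : Matrix (Fin s) (Fin n) ℤ) (J : Finset (Fin n)) :
    coneOf s n M J = {x | (fiber (col s n M) J x).Nonempty} := by
  ext x
  constructor
  · rintro ⟨a, h1, h2, rfl⟩
    exact ⟨WithLp.toLp 2 a, h1, h2, comb_apply _ _⟩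
  · rintro ⟨y, h1, h2, h3⟩
    exact ⟨y.ofLp, h1, h2, by rw [← h3, comb_apply]⟩

lemma finrank_relations_univ {s n : ℕ} {v : Fin n → Fin s → ℝ}
    (hv : Submodule.span ℝ (Set.range v) = ⊤) :
    Module.finrank ℝ (relations v Finset.univ) + s = n := by
  obtain ⟨r, -, hr⟩ := exists_linear_section (v := v) (J := Finset.univ) (by simpa using hv)
  have hker : relations v Finset.univ = (comb v).ker := by
    ext k
    simp [mem_relations]
  have hrange : (comb v).range = ⊤ := LinearMap.range_eq_top.2 fun x => ⟨r x, hr x⟩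
  have := LinearMap.finrank_range_add_finrank_ker (comb v)
  rw [hrange, finrank_top, ← hker] at this
  simp only [Module.finrank_fin_fun, finrank_euclideanSpace, Fintype.card_fin] at this
  omega

lemma Tfull_eq {s n : ℕ} {M : Matrix (Fin s) (Fin n) ℤ}
    (hspan : Submodule.span ℝ (Set.range (col s n M)) = ⊤) (x : Fin s → ℝ) :
    Tfull s n M x = (fiberVol (col s n M) Finset.univ x).toReal /
      (ENNReal.ofReal (Real.sqrt
        ((M.map (Int.cast : ℤ → ℝ) * (M.map (Int.cast : ℤ → ℝ))ᵀ).det))).toReal := by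
  have hdim : (n : ℝ) - s = Module.finrank ℝ (relations (col s n M) Finset.univ) := by
    rw [sub_eq_iff_eq_add]
    exact_mod_cast (finrank_relations_univ hspan).symm
  rw [Tfull, ENNReal.toReal_div, hdim, fiberVol]
  congr 4
  ext y
  simp only [Finset.mem_univ, not_true_eq_false, false_imp_iff,
    implies_true, true_and, comb_apply, funext_iff, Finset.sum_apply, Pi.smul_apply, smul_eq_mul,
    _root_.col, mul_comm]

/-- On each fundamental `M`-cone `Ω`, the truncated power `T(·|M)` agrees with a
homogeneous polynomial of degree `n - s` belonging to `D(M)` (i.e. annihilated by `D_Y`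
for every `Y ∈ 𝒴(M)`). -/
theorem truncated_power_polynomial_on_cone (s n : ℕ) (hs : 1 ≤ s) (hn : s ≤ n)
    (M : Matrix (Fin s) (Fin n) ℤ)
    (hspan : Submodule.span ℝ (Set.range (col s n M)) = ⊤)
    (hhull : (0 : Fin s → ℝ) ∉ convexHull ℝ (Set.range (col s n M)))
    (Ω : Set (Fin s → ℝ)) (hΩ : IsFundCone s n M Ω) :
    ∃ p : MvPolynomial (Fin s) ℝ, p.IsHomogeneous (n - s) ∧
      (∀ Y : Finset (Fin n),
        Submodule.span ℝ (col s n M '' ↑Yᶜ) ≠ ⊤ →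
        DY s (Y.toList.map (col s n M)) (fun x => MvPolynomial.eval x p) = 0) ∧
      ∀ x ∈ Ω, Tfull s n M x = MvPolynomial.eval x p := by
  obtain ⟨ℓ, hℓ⟩ := exists_pos_functional_s17 _ hhull
  obtain ⟨x₀, hx₀, rfl⟩ := hΩ
  set U := interior (coneOf s n M Finset.univ) \ badSet s n M
  have hU : ∀ x ∈ U, ∀ J : Finset (Fin n), Submodule.span ℝ (col s n M '' J) ≠ ⊤ →
      fiber (col s n M) J x = ∅ := by
    rintro x ⟨-, hx⟩ J hJ
    by_contra hne
    refine hx (Set.mem_biUnion (x := J) hJ ?_)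
    rw [coneOf_eq_fiber_nonempty]
    exact Set.nonempty_iff_ne_empty.2 hne
  have hloc := fun x (hx : x ∈ U) => exists_local_polynomial hℓ (hU x hx) Finset.univ
    (by simpa using hspan)
  choose! p hp1 hp2 hp3 using hloc
  have hsub : connectedComponentIn U x₀ ⊆ U := connectedComponentIn_subset U x₀
  have hconst : ∀ x ∈ connectedComponentIn U x₀, p x = p x₀ := by
    intro x hx
    refine isPreconnected_connectedComponentIn.induction₂ (fun y z => p y = p z) ?_
      (fun _ _ _ _ _ _ => Eq.trans) (fun _ _ _ _ => Eq.symm) hx (mem_connectedComponentIn hx₀)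
    intro y hy
    filter_upwards [mem_nhdsWithin_of_mem_nhds (hp3 y (hsub hy)).eventually_nhds,
      self_mem_nhdsWithin] with z hz hzΩ
    refine eq_of_eventually_eval_eq (x₀ := z) ?_
    filter_upwards [hz, hp3 z (hsub hzΩ)] with w h1 h2
    rw [← h1, h2]
  set c : ℝ := (ENNReal.ofReal (Real.sqrt
    ((M.map (Int.cast : ℤ → ℝ) * (M.map (Int.cast : ℤ → ℝ))ᵀ).det))).toReal with hc
  refine ⟨MvPolynomial.C c⁻¹ * p x₀, ?_, fun Y hY => ?_, fun x hx => ?_⟩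
  · have hdim : Module.finrank ℝ (relations (col s n M) Finset.univ) = n - s := by
      have := finrank_relations_univ hspan
      omega
    exact hdim ▸ (hp1 x₀ hx₀).C_mul c⁻¹
  · have h0 := hp2 x₀ hx₀ Y.toList Y.nodup_toList (fun _ _ => Finset.mem_univ _)
      (by rwa [Finset.toList_toFinset, ← Finset.compl_eq_univ_sdiff])
    rw [DY_eval, ← MvPolynomial.smul_eq_C_mul, foldr_dirDeriv_smul, h0, smul_zero]
    funext x
    exact map_zero _
  · rw [Tfull_eq hspan, ← hc, (hp3 x (hsub hx)).self_of_nhds, hconst x hx, map_mul,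
      MvPolynomial.eval_C, div_eq_inv_mul]
end
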